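/- For every family of sets {M_n} satisfying properties 1–5 and every state ρ ∈ D(ℋ): lim_{n→∞} min_{ω_n ∈ M_n} tr(ρ^{⊗n} − 2^{yn} ω_n)₊ equals 0 for every real y > E_M^∞(ρ), and equals 1 for every real y < E_M^∞(ρ). -/

import Mathlib

open scoped BigOperators
open Filter ComplexOrder

noncomputable section

namespace GQSL

variable {I : Type*} [Fintype I] [DecidableEq I]

/-- A quantum state: a positive semidefinite matrix of unit trace. -/
def IsState (ρ : Matrix I I ℂ) : Prop := ρ.PosSemidef ∧ ρ.trace = 1

/-- The `n`-fold tensor power of an operator, realized on `Fin n → I` indices. -/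
def tpow (ρ : Matrix I I ℂ) (n : ℕ) : Matrix (Fin n → I) (Fin n → I) ℂ :=
  fun x y => ∏ i, ρ (x i) (y i)

/-- Functional calculus for Hermitian matrices (junk value `0` otherwise). -/
def fcal (f : ℝ → ℝ) (A : Matrix I I ℂ) : Matrix I I ℂ :=
  if hA : A.IsHermitian then
    (hA.eigenvectorUnitary : Matrix I I ℂ) *
      Matrix.diagonal (fun i => (f (hA.eigenvalues i) : ℂ)) *
      star (hA.eigenvectorUnitary : Matrix I I ℂ)
  else 0

/-- Base-2 matrix logarithm, computed on the support. -/
def mlog (A : Matrix I I ℂ) : Matrix I I ℂ :=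
  fcal (fun x => if 0 < x then Real.logb 2 x else 0) A

/-- Real matrix power, computed on the support (generalized inverse powers). -/
def mpow (A : Matrix I I ℂ) (t : ℝ) : Matrix I I ℂ :=
  fcal (fun x => if 0 < x then x ^ t else 0) A

/-- Matrix square root of a positive semidefinite matrix. -/
def msqrt (A : Matrix I I ℂ) : Matrix I I ℂ := fcal Real.sqrt A

/-- Trace norm `‖A‖₁ = tr √(AᴴA)`. -/
def trNorm (A : Matrix I I ℂ) : ℝ := ((msqrt (A.conjTranspose * A)).trace).re

/-- Trace of the positive part of a Hermitian matrix: the sum of its positive eigenvalues. -/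
def trPos (A : Matrix I I ℂ) : ℝ := ((fcal (fun x => max x 0) A).trace).re

/-- Fidelity `F(A,B) = tr √(√A B √A)`. -/
def fid (A B : Matrix I I ℂ) : ℝ := ((msqrt (msqrt A * B * msqrt A)).trace).re

/-- Von Neumann entropy (base 2). -/
def vnEnt (A : Matrix I I ℂ) : ℝ := -((A * mlog A).trace).re

/-- `supp ρ ⊆ supp σ`, expressed via kernels. -/
def SuppLe (ρ σ : Matrix I I ℂ) : Prop := ∀ v, σ.mulVec v = 0 → ρ.mulVec v = 0

/-- Quantum relative entropy `S(ρ‖σ) = tr(ρ(log₂ρ − log₂σ))` (finite-value formula,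
meaningful when `SuppLe ρ σ` holds). -/
def relEnt (ρ σ : Matrix I I ℂ) : ℝ := ((ρ * (mlog ρ - mlog σ)).trace).re

/-- `E_M(ρ) = inf {S(ρ‖σ) : σ ∈ M}`; states `σ` violating the support condition
have `S(ρ‖σ) = +∞` and hence do not contribute to the infimum. -/
def EMset (M : Set (Matrix I I ℂ)) (ρ : Matrix I I ℂ) : ℝ :=
  sInf {x | ∃ σ ∈ M, SuppLe ρ σ ∧ x = relEnt ρ σ}

/-- Max-relative entropy `S_max(ρ‖σ) = inf {s : ρ ≤ 2^s σ}`. -/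
def Smax (ρ σ : Matrix I I ℂ) : ℝ := sInf {s : ℝ | (((2:ℝ) ^ s) • σ - ρ).PosSemidef}

/-- Log robustness with respect to a set `M`. -/
def LR (M : Set (Matrix I I ℂ)) (ρ : Matrix I I ℂ) : ℝ :=
  sInf {x | ∃ σ ∈ M, x = Smax ρ σ}

/-- Smoothed log robustness. -/
def LReps (M : Set (Matrix I I ℂ)) (ε : ℝ) (ρ : Matrix I I ℂ) : ℝ :=
  sInf {x | ∃ ρ', IsState ρ' ∧ trNorm (ρ' - ρ) ≤ ε ∧ x = LR M ρ'}

/-- Partial trace over the `k`-th tensor factor. -/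
def ptraceAt {n : ℕ} (k : Fin (n + 1)) (ρ : Matrix (Fin (n + 1) → I) (Fin (n + 1) → I) ℂ) :
    Matrix (Fin n → I) (Fin n → I) ℂ :=
  fun x y => ∑ a : I, ρ (k.insertNth a x) (k.insertNth a y)

/-- Tensor product of operators on `n` and `m` copies. -/
def tprod {n m : ℕ} (ρ : Matrix (Fin n → I) (Fin n → I) ℂ)
    (ν : Matrix (Fin m → I) (Fin m → I) ℂ) :
    Matrix (Fin (n + m) → I) (Fin (n + m) → I) ℂ :=
  fun x y => ρ (fun i => x (Fin.castAdd m i)) (fun i => y (Fin.castAdd m i)) *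
    ν (fun j => x (Fin.natAdd n j)) (fun j => y (Fin.natAdd n j))

/-- Conjugation `P_π ρ P_π†` by the permutation unitary. -/
def permute {n : ℕ} (π : Equiv.Perm (Fin n)) (ρ : Matrix (Fin n → I) (Fin n → I) ℂ) :
    Matrix (Fin n → I) (Fin n → I) ℂ :=
  fun x y => ρ (x ∘ π) (y ∘ π)

/-- A family of sets of states satisfying properties 1–5, with `σ` the fixed
full-rank state of property 2. -/
structure GoodFamily {d : ℕ} (σ : Matrix (Fin d) (Fin d) ℂ)
    (M : ∀ n : ℕ, Set (Matrix (Fin n → Fin d) (Fin n → Fin d) ℂ)) : Prop where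
  states : ∀ n, ∀ ρ ∈ M n, IsState ρ
  convex : ∀ n, Convex ℝ (M n)
  closed : ∀ n, IsClosed (M n)
  sigma_state : IsState σ
  sigma_posdef : σ.PosDef
  sigma_mem : ∀ n, tpow σ n ∈ M n
  ptrace_mem : ∀ n (k : Fin (n + 1)), ∀ ρ ∈ M (n + 1), ptraceAt k ρ ∈ M n
  tprod_mem : ∀ n m, ∀ ρ ∈ M n, ∀ ν ∈ M m, tprod ρ ν ∈ M (n + m)
  perm_mem : ∀ n (π : Equiv.Perm (Fin n)), ∀ ρ ∈ M n, permute π ρ ∈ M n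

/-- The rank-one operator `|f⟩⟨f|`. -/
def vecOp {J : Type*} (f : J → ℂ) : Matrix J J ℂ := fun x y => f x * star (f y)

/-- Squared ℓ²-norm of a vector. -/
def vecNormSq {J : Type*} [Fintype J] (f : J → ℂ) : ℝ := ∑ x, Complex.normSq (f x)

/-- ℓ²-norm of a vector. -/
def l2norm {J : Type*} [Fintype J] (f : J → ℂ) : ℝ := Real.sqrt (vecNormSq f)

/-- Membership in the symmetric subspace. -/
def IsSymVec {J : Type*} {N : ℕ} (f : (Fin N → J) → ℂ) : Prop :=
  ∀ (π : Equiv.Perm (Fin N)) (x : Fin N → J), f (x ∘ π) = f x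

/-- Unnormalized symmetrization `Σ_π P_π ψ`. -/
def symmetrize {J : Type*} {N : ℕ} (ψ : (Fin N → J) → ℂ) : (Fin N → J) → ℂ :=
  fun x => ∑ π : Equiv.Perm (Fin N), ψ (x ∘ π)

/-- Normalized symmetrization `Sym(ψ)`. -/
def SymOf {J : Type*} [Fintype J] {N : ℕ} (ψ : (Fin N → J) → ℂ) : (Fin N → J) → ℂ :=
  ((l2norm (symmetrize ψ) : ℂ))⁻¹ • symmetrize ψ

/-- Partial trace over the first `m` of `m + k` tensor factors. -/
def ptraceFirst {J : Type*} [Fintype J] [DecidableEq J] {m k : ℕ}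
    (ρ : Matrix (Fin (m + k) → J) (Fin (m + k) → J) ℂ) :
    Matrix (Fin k → J) (Fin k → J) ℂ :=
  fun x y => ∑ a : Fin m → J, ρ (Fin.append a x) (Fin.append a y)

/-- Partial trace over the environment components of `N` system–environment pairs. -/
def ptraceE {A E : Type*} [Fintype A] [Fintype E] {N : ℕ}
    (ρ : Matrix (Fin N → A × E) (Fin N → A × E) ℂ) :
    Matrix (Fin N → A) (Fin N → A) ℂ :=
  fun x y => ∑ e : Fin N → E, ρ (fun i => (x i, e i)) (fun i => (y i, e i))

/-- The set of `(N choose r)`-i.i.d. vectors along `θ`: vectors which are `θ` on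
`N − r` of the positions (the permutations of `θ^{⊗(N−r)} ⊗ ψ_r`). -/
def powVecSet {J : Type*} (θ : J → ℂ) (N r : ℕ) : Set ((Fin N → J) → ℂ) :=
  {f | ∃ S : Finset (Fin N), S.card = N - r ∧
    ∃ ψ : ({i : Fin N // i ∉ S} → J) → ℂ,
      f = fun x => (∏ i ∈ S, θ (x i)) * ψ (fun j => x j.1)}

/-- Almost power states along `θ`: `|θ⟩^{[⊗,N,r]} = Sym(ℋ^{⊗N}) ∩ span V(ℋ^{⊗N}, θ^{⊗N−r})`. -/
def almostPower {J : Type*} (θ : J → ℂ) (N r : ℕ) : Set ((Fin N → J) → ℂ) :=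
  {f | IsSymVec f ∧ f ∈ Submodule.span ℂ (powVecSet θ N r)}

/-- `η ⊗ θ^{⊗(N−k)}`: the vector `η` on the first `k` slots and `θ` on the rest. -/
def etaTensor {J : Type*} {N k : ℕ} (h : k ≤ N) (η : (Fin k → J) → ℂ) (θ : J → ℂ) :
    (Fin N → J) → ℂ :=
  fun x => η (fun i => x (Fin.castLE h i)) * ∏ i : Fin N, if (i : ℕ) < k then 1 else θ (x i)

/-- `η` lies in the `k`-fold tensor power of the orthogonal complement of `θ`:
the contraction of `η` with `⟨θ|` at any slot vanishes. -/
def InPerpPow {J : Type*} [Fintype J] [DecidableEq J] {k : ℕ} (θ : J → ℂ)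
    (η : (Fin k → J) → ℂ) : Prop :=
  ∀ (j : Fin k) (z : Fin k → J), ∑ a : J, star (θ a) * η (Function.update z j a) = 0

/-- Binary Shannon entropy. -/
def binEnt (x : ℝ) : ℝ := -(x * Real.logb 2 x) - (1 - x) * Real.logb 2 (1 - x)

/-- Product operator `σ₁ ⊗ ⋯ ⊗ σ_k` of a `k`-partite system. -/
def prodOp {k : ℕ} {ι : Fin k → Type*} [∀ i, Fintype (ι i)]
    (σs : ∀ i, Matrix (ι i) (ι i) ℂ) : Matrix (∀ i, ι i) (∀ i, ι i) ℂ :=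
  fun x y => ∏ i, σs i (x i) (y i)

/-- Separability of a `k`-partite state: a finite convex combination of product states. -/
def IsSeparable {k : ℕ} {ι : Fin k → Type*} [∀ i, Fintype (ι i)]
    (ρ : Matrix (∀ i, ι i) (∀ i, ι i) ℂ) : Prop :=
  ∃ (m : ℕ) (p : Fin m → ℝ) (σs : Fin m → ∀ i, Matrix (ι i) (ι i) ℂ),
    (∀ j, 0 ≤ p j) ∧ (∑ j, p j = 1) ∧ (∀ j i, IsState (σs j i)) ∧
    ρ = ∑ j, p j • prodOp (σs j)

/-- Relative entropy of entanglement `E_R(ρ) = inf {S(ρ‖ω) : ω separable}`. -/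
def ERel {k : ℕ} {ι : Fin k → Type*} [∀ i, Fintype (ι i)] [∀ i, DecidableEq (ι i)]
    (ρ : Matrix (∀ i, ι i) (∀ i, ι i) ℂ) : ℝ :=
  sInf {x | ∃ ω, IsSeparable ω ∧ SuppLe ρ ω ∧ x = relEnt ρ ω}

/-- `ρ^{⊗n}` of a `k`-partite state, viewed as a `k`-partite state where the `i`-th
party holds the `n` copies of its system. -/
def tpowMulti {k : ℕ} {d : Fin k → ℕ} (ρ : Matrix (∀ i, Fin (d i)) (∀ i, Fin (d i)) ℂ)
    (n : ℕ) : Matrix (∀ i, Fin n → Fin (d i)) (∀ i, Fin n → Fin (d i)) ℂ :=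
  fun x y => ∏ t : Fin n, ρ (fun i => x i t) (fun i => y i t)

/-- `ρ^{⊗n}` of a bipartite state in the grouped bipartition `A^{⊗n} : B^{⊗n}`. -/
def tpowBi {A B : Type*} [Fintype A] [Fintype B]
    (ρ : Matrix (A × B) (A × B) ℂ) (n : ℕ) :
    Matrix ((Fin n → A) × (Fin n → B)) ((Fin n → A) × (Fin n → B)) ℂ :=
  fun x y => ∏ i, ρ (x.1 i, x.2 i) (y.1 i, y.2 i)

/-- `k`-extendibility of a bipartite state. -/
def IsKExtendible {A B : Type*} [Fintype A] [Fintype B] (k : ℕ)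
    (σ : Matrix (A × B) (A × B) ℂ) : Prop :=
  ∃ σ' : Matrix (A × (Fin k → B)) (A × (Fin k → B)) ℂ,
    IsState σ' ∧
    (∀ (π : Equiv.Perm (Fin k)) (p q : A × (Fin k → B)),
      σ' (p.1, p.2 ∘ π) (q.1, q.2 ∘ π) = σ' p q) ∧
    (∀ p q : A × B, σ p q =
      ∑ f : {i : Fin k // (i : ℕ) ≠ 0} → B,
        σ' (p.1, fun i => if h : (i : ℕ) = 0 then p.2 else f ⟨i, h⟩)
           (q.1, fun i => if h : (i : ℕ) = 0 then q.2 else f ⟨i, h⟩))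

set_option linter.unusedSectionVars false

open scoped Matrix

/-- `A = U diag(a) Uᴴ` with `U` unitary and `a` real. -/
def SpecDec (A U : Matrix I I ℂ) (a : I → ℝ) : Prop :=
  U ∈ Matrix.unitaryGroup I ℂ ∧ A = U * Matrix.diagonal (fun i => (a i : ℂ)) * Uᴴ

/-- The diagonal entry `⟨uᵢ|A|uᵢ⟩` (real part) in the basis of columns of `U`. -/
def qform (A U : Matrix I I ℂ) (i : I) : ℝ := ((Uᴴ * A * U) i i).re

lemma unitary_conjTranspose_mul {U : Matrix I I ℂ} (hU : U ∈ Matrix.unitaryGroup I ℂ) :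
    Uᴴ * U = 1 := Matrix.mem_unitaryGroup_iff'.1 hU

lemma unitary_mul_conjTranspose {U : Matrix I I ℂ} (hU : U ∈ Matrix.unitaryGroup I ℂ) :
    U * Uᴴ = 1 := Matrix.mem_unitaryGroup_iff.1 hU

lemma conjTranspose_mem_unitary {U : Matrix I I ℂ} (hU : U ∈ Matrix.unitaryGroup I ℂ) :
    Uᴴ ∈ Matrix.unitaryGroup I ℂ := by
  rw [Matrix.mem_unitaryGroup_iff, Matrix.star_eq_conjTranspose, Matrix.conjTranspose_conjTranspose]
  exact unitary_conjTranspose_mul hU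

lemma exists_specDec {A : Matrix I I ℂ} (hA : A.IsHermitian) : ∃ U a, SpecDec A U a := by
  refine ⟨hA.eigenvectorUnitary.1, hA.eigenvalues, hA.eigenvectorUnitary.2, ?_⟩
  have h := hA.spectral_theorem
  rw [Unitary.conjStarAlgAut_apply] at h
  exact h

lemma SpecDec.isHermitian {A U : Matrix I I ℂ} {a : I → ℝ} (h : SpecDec A U a) :
    A.IsHermitian := by
  rw [h.2, Matrix.IsHermitian, Matrix.conjTranspose_mul, Matrix.conjTranspose_mul,
    Matrix.conjTranspose_conjTranspose, Matrix.diagonal_conjTranspose, Matrix.mul_assoc]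
  congr 3
  ext i
  simp

/-- Functional calculus does not depend on the chosen diagonalization. -/
lemma fcal_eq {A U : Matrix I I ℂ} {a : I → ℝ} (h : SpecDec A U a) (f : ℝ → ℝ) :
    fcal f A = U * Matrix.diagonal (fun i => (f (a i) : ℂ)) * Uᴴ := by
  have hA := h.isHermitian
  rw [fcal, dif_pos hA]
  set V : Matrix I I ℂ := hA.eigenvectorUnitary.1 with hV
  set b := hA.eigenvalues with hb
  have hVu : V ∈ Matrix.unitaryGroup I ℂ := hA.eigenvectorUnitary.2
  have hd : A = V * Matrix.diagonal (fun i => (b i : ℂ)) * Vᴴ := by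
    have h := hA.spectral_theorem
    rw [Unitary.conjStarAlgAut_apply] at h
    exact h
  have hX : Vᴴ * U * Matrix.diagonal (fun i => (a i : ℂ))
      = Matrix.diagonal (fun i => (b i : ℂ)) * (Vᴴ * U) := by
    have h1 : Vᴴ * A * U = Vᴴ * U * Matrix.diagonal (fun i => (a i : ℂ)) := by
      rw [h.2]
      simp only [Matrix.mul_assoc, unitary_conjTranspose_mul h.1, Matrix.mul_one]
    have h2 : Vᴴ * A * U = Matrix.diagonal (fun i => (b i : ℂ)) * (Vᴴ * U) := by
      rw [hd]
      simp only [← Matrix.mul_assoc, unitary_conjTranspose_mul hVu, Matrix.one_mul]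
    rw [← h1, h2]
  have hY : Vᴴ * U * Matrix.diagonal (fun i => (f (a i) : ℂ))
      = Matrix.diagonal (fun i => (f (b i) : ℂ)) * (Vᴴ * U) := by
    ext i j
    have := congrFun (congrFun hX i) j
    rw [Matrix.mul_diagonal, Matrix.diagonal_mul] at this ⊢
    by_cases h0 : (Vᴴ * U) i j = 0
    · simp [h0]
    · have : (a j : ℂ) = b i := by
        apply mul_left_cancel₀ h0
        rw [this, mul_comm]
      have : a j = b i := by exact_mod_cast this
      rw [this, mul_comm]
  calc V * Matrix.diagonal (fun i => (f (b i) : ℂ)) * Vᴴ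
      = V * (Matrix.diagonal (fun i => (f (b i) : ℂ)) * (Vᴴ * U)) * Uᴴ := by
        simp only [Matrix.mul_assoc, unitary_mul_conjTranspose h.1, Matrix.mul_one]
    _ = U * Matrix.diagonal (fun i => (f (a i) : ℂ)) * Uᴴ := by
        rw [← hY]
        simp only [← Matrix.mul_assoc, unitary_mul_conjTranspose hVu, Matrix.one_mul]

lemma sum_normSq_col {U : Matrix I I ℂ} (hU : U ∈ Matrix.unitaryGroup I ℂ) (j : I) :
    ∑ i, Complex.normSq (U i j) = 1 := by
  have h := congrFun (congrFun (unitary_conjTranspose_mul hU) j) j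
  rw [Matrix.mul_apply, Matrix.one_apply_eq] at h
  have h2 : ((∑ i, Complex.normSq (U i j) : ℝ) : ℂ) = 1 := by
    rw [← h]
    push_cast
    refine Finset.sum_congr rfl fun i _ => ?_
    rw [Complex.normSq_eq_conj_mul_self]
    rfl
  exact_mod_cast h2

lemma sum_normSq_row {U : Matrix I I ℂ} (hU : U ∈ Matrix.unitaryGroup I ℂ) (i : I) :
    ∑ j, Complex.normSq (U i j) = 1 := by
  have h := sum_normSq_col (conjTranspose_mem_unitary hU) i
  simpa [Matrix.conjTranspose_apply] using h

lemma qform_eq {A V : Matrix I I ℂ} {a : I → ℝ} (h : SpecDec A V a) (U : Matrix I I ℂ) (i : I) :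
    qform A U i = ∑ j, a j * Complex.normSq ((Vᴴ * U) j i) := by
  have : Uᴴ * A * U = (Vᴴ * U)ᴴ * Matrix.diagonal (fun i => (a i : ℂ)) * (Vᴴ * U) := by
    rw [h.2, Matrix.conjTranspose_mul, Matrix.conjTranspose_conjTranspose]
    simp only [Matrix.mul_assoc]
  rw [qform, this, Matrix.mul_apply, Complex.re_sum]
  refine Finset.sum_congr rfl fun j _ => ?_
  rw [Matrix.mul_diagonal, Matrix.conjTranspose_apply, mul_right_comm, Complex.star_def,
    ← Complex.normSq_eq_conj_mul_self, mul_comm, ← Complex.ofReal_mul, Complex.ofReal_re]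

lemma qform_self {A U : Matrix I I ℂ} {a : I → ℝ} (h : SpecDec A U a) (i : I) :
    qform A U i = a i := by
  rw [qform_eq h, unitary_conjTranspose_mul h.1, Finset.sum_eq_single i]
  · simp
  · intro j _ hj
    simp [Matrix.one_apply_ne hj]
  · simp

lemma qform_sub (A B U : Matrix I I ℂ) (i : I) :
    qform (A - B) U i = qform A U i - qform B U i := by
  simp [qform, Matrix.mul_sub, Matrix.sub_mul]

lemma qform_add (A B U : Matrix I I ℂ) (i : I) :
    qform (A + B) U i = qform A U i + qform B U i := by
  simp [qform, Matrix.mul_add, Matrix.add_mul]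

lemma qform_smul (c : ℝ) (A U : Matrix I I ℂ) (i : I) :
    qform (c • A) U i = c * qform A U i := by
  simp [qform]

lemma qform_nonneg {A : Matrix I I ℂ} (hA : A.PosSemidef) (U : Matrix I I ℂ) (i : I) :
    0 ≤ qform A U i := by
  have := (hA.conjTranspose_mul_mul_same U).diag_nonneg (i := i)
  exact (Complex.le_def.1 this).1

lemma sum_qform {A U : Matrix I I ℂ} (hU : U ∈ Matrix.unitaryGroup I ℂ) :
    ∑ i, qform A U i = A.trace.re := by
  have : (Uᴴ * A * U).trace = A.trace := by
    rw [Matrix.trace_mul_comm, ← Matrix.mul_assoc, unitary_mul_conjTranspose hU, Matrix.one_mul]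
  rw [← this, Matrix.trace, Complex.re_sum]
  rfl

lemma trace_mul_fcal {A V : Matrix I I ℂ} {a : I → ℝ} (h : SpecDec A V a) (f : ℝ → ℝ)
    (B : Matrix I I ℂ) : ((B * fcal f A).trace).re = ∑ j, qform B V j * f (a j) := by
  rw [fcal_eq h, ← Matrix.mul_assoc, Matrix.trace_mul_comm, ← Matrix.mul_assoc,
    ← Matrix.mul_assoc, Matrix.trace, Complex.re_sum]
  refine Finset.sum_congr rfl fun j _ => ?_
  rw [Matrix.diag_apply, Matrix.mul_diagonal, qform, Complex.re_mul_ofReal]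

lemma trPos_eq {A U : Matrix I I ℂ} {a : I → ℝ} (h : SpecDec A U a) :
    trPos A = ∑ i, max (a i) 0 := by
  have h1 := trace_mul_fcal h (fun x => max x 0) 1
  rw [Matrix.one_mul] at h1
  rw [trPos, h1]
  refine Finset.sum_congr rfl fun j _ => ?_
  simp [qform, unitary_conjTranspose_mul h.1]

lemma relEnt_eq {ρ ω U V : Matrix I I ℂ} {r t : I → ℝ} (hr : SpecDec ρ U r)
    (ht : SpecDec ω V t) (hr0 : ∀ i, 0 ≤ r i) (ht0 : ∀ i, 0 ≤ t i) :
    relEnt ρ ω = ∑ i, r i * Real.logb 2 (r i) - ∑ j, qform ρ V j * Real.logb 2 (t j) := by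
  have key : ∀ x : ℝ, 0 ≤ x → (if 0 < x then Real.logb 2 x else 0) = Real.logb 2 x := by
    intro x hx
    split_ifs with h
    · rfl
    · rw [le_antisymm (not_lt.1 h) hx, Real.logb_zero]
  rw [relEnt, Matrix.mul_sub, Matrix.trace_sub, Complex.sub_re, mlog, mlog, trace_mul_fcal hr,
    trace_mul_fcal ht]
  simp only [key _ (hr0 _), key _ (ht0 _), qform_self hr]

/-- Any projective test in an orthonormal basis is bounded by the trace of the positive part. -/
lemma sum_qform_le_trPos {A U : Matrix I I ℂ} (hA : A.IsHermitian)
    (hU : U ∈ Matrix.unitaryGroup I ℂ) (S : Finset I) : ∑ i ∈ S, qform A U i ≤ trPos A := by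
  obtain ⟨V, a, h⟩ := exists_specDec hA
  have hX : Vᴴ * U ∈ Matrix.unitaryGroup I ℂ := mul_mem (conjTranspose_mem_unitary h.1) hU
  rw [trPos_eq h]
  calc ∑ i ∈ S, qform A U i
      = ∑ i ∈ S, ∑ j, a j * Complex.normSq ((Vᴴ * U) j i) := by simp only [qform_eq h]
    _ ≤ ∑ i ∈ S, ∑ j, max (a j) 0 * Complex.normSq ((Vᴴ * U) j i) := by
        gcongr with i _ j _
        · exact Complex.normSq_nonneg _
        · exact le_max_left _ _
    _ ≤ ∑ i, ∑ j, max (a j) 0 * Complex.normSq ((Vᴴ * U) j i) := by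
        refine Finset.sum_le_sum_of_subset_of_nonneg (Finset.subset_univ _) fun i _ _ => ?_
        exact Finset.sum_nonneg fun j _ =>
          mul_nonneg (le_max_right _ _) (Complex.normSq_nonneg _)
    _ = ∑ j, max (a j) 0 := by
        rw [Finset.sum_comm]
        simp only [← Finset.mul_sum, sum_normSq_row hX, mul_one]

/-- The trace of the positive part is attained by a projective test. -/
lemma exists_trPos_eq {A : Matrix I I ℂ} (hA : A.IsHermitian) :
    ∃ U ∈ Matrix.unitaryGroup I ℂ, ∃ S : Finset I, trPos A = ∑ i ∈ S, qform A U i := by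
  obtain ⟨U, a, h⟩ := exists_specDec hA
  refine ⟨U, h.1, Finset.univ.filter (fun i => 0 < a i), ?_⟩
  rw [trPos_eq h, Finset.sum_filter]
  refine Finset.sum_congr rfl fun i _ => ?_
  rw [qform_self h]
  split_ifs with h0
  · exact max_eq_left h0.le
  · exact max_eq_right (not_lt.1 h0)

lemma trPos_nonneg {A : Matrix I I ℂ} (hA : A.IsHermitian) : 0 ≤ trPos A := by
  simpa using sum_qform_le_trPos hA (one_mem (Matrix.unitaryGroup I ℂ)) ∅

lemma isHermitian_sub_smul {A B : Matrix I I ℂ} (hA : A.IsHermitian) (hB : B.IsHermitian)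
    (c : ℝ) : (A - c • B).IsHermitian :=
  hA.sub (IsSelfAdjoint.smul (IsSelfAdjoint.all c) hB)

/-- Monotonicity of the trace of the positive part in the subtracted operator. -/
lemma trPos_sub_smul_le {ρ ω τ : Matrix I I ℂ} {b c : ℝ} (hρ : ρ.IsHermitian)
    (hω : ω.IsHermitian) (hτ : τ.IsHermitian)
    (h : ∀ (U : Matrix I I ℂ) (i : I), c * qform τ U i ≤ b * qform ω U i) :
    trPos (ρ - b • ω) ≤ trPos (ρ - c • τ) := by
  obtain ⟨U, hU, S, hS⟩ := exists_trPos_eq (isHermitian_sub_smul hρ hω b)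
  rw [hS]
  refine le_trans (Finset.sum_le_sum fun i _ => ?_)
    (sum_qform_le_trPos (isHermitian_sub_smul hρ hτ c) hU S)
  rw [qform_sub, qform_sub, qform_smul, qform_smul]
  linarith [h U i]

lemma trPos_sub_smul_le_one {ρ ω : Matrix I I ℂ} (hρ : IsState ρ) (hω : IsState ω) {c : ℝ}
    (hc : 0 ≤ c) : trPos (ρ - c • ω) ≤ 1 := by
  obtain ⟨U, hU, S, hS⟩ := exists_trPos_eq (isHermitian_sub_smul hρ.1.1 hω.1.1 c)
  rw [hS]
  calc ∑ i ∈ S, qform (ρ - c • ω) U i ≤ ∑ i ∈ S, qform ρ U i := by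
        refine Finset.sum_le_sum fun i _ => ?_
        rw [qform_sub, qform_smul]
        linarith [mul_nonneg hc (qform_nonneg hω.1 U i)]
    _ ≤ ∑ i, qform ρ U i := Finset.sum_le_sum_of_subset_of_nonneg (Finset.subset_univ _)
        fun i _ _ => qform_nonneg hρ.1 U i
    _ = 1 := by rw [sum_qform hU, hρ.2, Complex.one_re]

lemma SpecDec.nonneg {A U : Matrix I I ℂ} {a : I → ℝ} (h : SpecDec A U a) (hA : A.PosSemidef)
    (i : I) : 0 ≤ a i := qform_self h i ▸ qform_nonneg hA U i

lemma SpecDec.sum_eq_one {A U : Matrix I I ℂ} {a : I → ℝ} (h : SpecDec A U a)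
    (hA : IsState A) : ∑ i, a i = 1 := by
  have := sum_qform (A := A) h.1
  simpa only [qform_self h, hA.2, Complex.one_re] using this

lemma SpecDec.le_one {A U : Matrix I I ℂ} {a : I → ℝ} (h : SpecDec A U a) (hA : IsState A)
    (i : I) : a i ≤ 1 :=
  h.sum_eq_one hA ▸ Finset.single_le_sum (fun j _ => h.nonneg hA.1 j) (Finset.mem_univ i)
lemma sum_normSq_mulVec {X : Matrix I I ℂ} (hX : X ∈ Matrix.unitaryGroup I ℂ) (v : I → ℂ) :
    ∑ i, Complex.normSq (∑ j, X i j * v j) = ∑ j, Complex.normSq (v j) := by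
  have h1 : ∀ w : I → ℂ, ((∑ i, Complex.normSq (w i) : ℝ) : ℂ) = star w ⬝ᵥ w := by
    intro w
    push_cast
    refine Finset.sum_congr rfl fun i _ => ?_
    rw [Complex.normSq_eq_conj_mul_self]
    rfl
  have h2 : star (X *ᵥ v) ⬝ᵥ (X *ᵥ v) = star v ⬝ᵥ v := by
    rw [Matrix.star_mulVec, Matrix.dotProduct_mulVec, Matrix.vecMul_vecMul,
      unitary_conjTranspose_mul hX, Matrix.vecMul_one]
  rw [← h1, ← h1] at h2
  exact_mod_cast h2

lemma normSq_add_le (z w : ℂ) :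
    Complex.normSq (z + w) ≤ 2 * Complex.normSq z + 2 * Complex.normSq w := by
  simp only [Complex.normSq_apply, Complex.add_re, Complex.add_im]
  nlinarith [sq_nonneg (z.re - w.re), sq_nonneg (z.im - w.im)]

/-- Splitting of a test `S` applied to a weighted family of vectors: large weights `r`, small
weights `t`, and a remainder controlled by the test of `t`. -/
lemma sum_weight_normSq_le {X Y : Matrix I I ℂ} (hX : X ∈ Matrix.unitaryGroup I ℂ)
    (hY : Y ∈ Matrix.unitaryGroup I ℂ) {r t : I → ℝ} (hr : ∀ a, 0 ≤ r a) (ht : ∀ j, 0 ≤ t j)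
    {α β : ℝ} (hα : 0 ≤ α) (hβ : 0 < β) (S : Finset I) :
    ∑ i ∈ S, ∑ a, r a * Complex.normSq ((X * Y) i a) ≤
      ∑ a, (if α < r a then r a else 0) +
      2 * ∑ j, (if t j < β then ∑ a, r a * Complex.normSq (Y j a) else 0) +
      2 * (α / β) * ∑ i ∈ S, ∑ j, t j * Complex.normSq (X i j) := by
  classical
  set good : I → I → ℂ := fun i a => ∑ j, X i j * (if t j < β then 0 else Y j a) with hgood
  set bad : I → I → ℂ := fun i a => ∑ j, X i j * (if t j < β then Y j a else 0) with hbad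
  have hsplit : ∀ i a, (X * Y) i a = good i a + bad i a := by
    intro i a
    rw [Matrix.mul_apply, hgood, hbad, ← Finset.sum_add_distrib]
    refine Finset.sum_congr rfl fun j _ => ?_
    split_ifs <;> simp
  have hnn : ∀ i a, 0 ≤ r a * Complex.normSq (bad i a) :=
    fun i a => mul_nonneg (hr a) (Complex.normSq_nonneg _)
  have hterm : ∀ i a, r a * Complex.normSq ((X * Y) i a) ≤
      (if α < r a then r a else 0) * Complex.normSq ((X * Y) i a) +
      2 * (r a * Complex.normSq (bad i a)) + 2 * (α * Complex.normSq (good i a)) := by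
    intro i a
    split_ifs with h
    · linarith [hnn i a, mul_nonneg hα (Complex.normSq_nonneg (good i a))]
    · have h1 := mul_le_mul_of_nonneg_left (normSq_add_le (good i a) (bad i a)) (hr a)
      rw [← hsplit] at h1
      have h2 := mul_le_mul_of_nonneg_right (not_lt.1 h) (Complex.normSq_nonneg (good i a))
      linarith
  have e1 : ∑ i ∈ S, ∑ a, (if α < r a then r a else 0) * Complex.normSq ((X * Y) i a) ≤
      ∑ a, (if α < r a then r a else 0) := by
    rw [Finset.sum_comm]
    refine Finset.sum_le_sum fun a _ => ?_
    rw [← Finset.mul_sum]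
    have h1 : ∑ i ∈ S, Complex.normSq ((X * Y) i a) ≤ 1 := by
      rw [← sum_normSq_col (mul_mem hX hY) a]
      exact Finset.sum_le_sum_of_subset_of_nonneg (Finset.subset_univ _)
        fun i _ _ => Complex.normSq_nonneg _
    have h0 : 0 ≤ (if α < r a then r a else 0) := by split_ifs <;> simp [hr]
    simpa using mul_le_mul_of_nonneg_left h1 h0
  have e2 : ∑ i ∈ S, ∑ a, r a * Complex.normSq (bad i a) ≤
      ∑ j, (if t j < β then ∑ a, r a * Complex.normSq (Y j a) else 0) := by
    calc ∑ i ∈ S, ∑ a, r a * Complex.normSq (bad i a)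
        ≤ ∑ i, ∑ a, r a * Complex.normSq (bad i a) :=
          Finset.sum_le_sum_of_subset_of_nonneg (Finset.subset_univ _)
            fun i _ _ => Finset.sum_nonneg fun a _ => hnn i a
      _ = ∑ a, ∑ j, r a * Complex.normSq (if t j < β then Y j a else 0) := by
          rw [Finset.sum_comm]
          refine Finset.sum_congr rfl fun a _ => ?_
          rw [← Finset.mul_sum, ← Finset.mul_sum, sum_normSq_mulVec hX]
      _ = _ := by
          rw [Finset.sum_comm]
          refine Finset.sum_congr rfl fun j _ => ?_
          split_ifs <;> simp
  have e3 : ∑ i ∈ S, ∑ a, Complex.normSq (good i a) ≤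
      β⁻¹ * ∑ i ∈ S, ∑ j, t j * Complex.normSq (X i j) := by
    rw [Finset.mul_sum]
    refine Finset.sum_le_sum fun i _ => ?_
    have h1 : ∀ a, good i a = ∑ j, Yᵀ a j * (if t j < β then 0 else X i j) := by
      intro a
      refine Finset.sum_congr rfl fun j _ => ?_
      rw [Matrix.transpose_apply]
      split_ifs <;> ring
    have hYt : Yᵀ ∈ Matrix.unitaryGroup I ℂ := by
      rw [Matrix.mem_unitaryGroup_iff, Matrix.star_eq_conjTranspose, Matrix.conjTranspose,
        Matrix.transpose_transpose, ← Matrix.transpose_one, ← unitary_conjTranspose_mul hY,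
        Matrix.transpose_mul]
      rfl
    simp only [h1]
    rw [sum_normSq_mulVec hYt, Finset.mul_sum]
    refine Finset.sum_le_sum fun j _ => ?_
    split_ifs with h
    · simpa using mul_nonneg (inv_nonneg.2 hβ.le) (mul_nonneg (ht j) (Complex.normSq_nonneg _))
    · rw [← mul_assoc]
      refine le_mul_of_one_le_left (Complex.normSq_nonneg _) ?_
      rw [inv_mul_eq_div, one_le_div hβ]
      exact not_lt.1 h
  calc ∑ i ∈ S, ∑ a, r a * Complex.normSq ((X * Y) i a)
      ≤ ∑ i ∈ S, ∑ a, ((if α < r a then r a else 0) * Complex.normSq ((X * Y) i a) +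
      2 * (r a * Complex.normSq (bad i a)) + 2 * (α * Complex.normSq (good i a))) :=
        Finset.sum_le_sum fun i _ => Finset.sum_le_sum fun a _ => hterm i a
    _ = ∑ i ∈ S, ∑ a, (if α < r a then r a else 0) * Complex.normSq ((X * Y) i a) +
        2 * ∑ i ∈ S, ∑ a, r a * Complex.normSq (bad i a) +
        2 * α * ∑ i ∈ S, ∑ a, Complex.normSq (good i a) := by
        simp only [Finset.sum_add_distrib, Finset.mul_sum, mul_assoc]
    _ ≤ _ := by
        have := mul_le_mul_of_nonneg_left e3 (mul_nonneg zero_le_two hα)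
        rw [div_eq_mul_inv]
        linarith

lemma trPos_sub_smul_le_tails {ρ ω U V : Matrix I I ℂ} {r t : I → ℝ} (hρ : IsState ρ)
    (hω : IsState ω) (hr : SpecDec ρ U r) (ht : SpecDec ω V t) {α β l : ℝ} (hα : 0 ≤ α)
    (hβ : 0 < β) (hl : 0 < l) :
    trPos (ρ - l • ω) ≤ ∑ a, (if α < r a then r a else 0) +
      2 * ∑ j, (if t j < β then qform ρ V j else 0) + 2 * (α / β) * l⁻¹ := by
  have hH := isHermitian_sub_smul hρ.1.1 hω.1.1 l
  obtain ⟨G, hG, S, hS⟩ := exists_trPos_eq hH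
  have hpos := trPos_nonneg hH
  set A := ∑ i ∈ S, qform ρ G i with hA
  set B := ∑ i ∈ S, qform ω G i with hB
  have hAB : trPos (ρ - l • ω) = A - l * B := by
    rw [hS, hA, hB, Finset.mul_sum, ← Finset.sum_sub_distrib]
    simp only [qform_sub, qform_smul]
  have hB0 : 0 ≤ B := Finset.sum_nonneg fun i _ => qform_nonneg hω.1 G i
  have hA1 : A ≤ 1 := by
    have : ∑ i, qform ρ G i = 1 := by rw [sum_qform hG, hρ.2, Complex.one_re]
    rw [← this]
    exact Finset.sum_le_sum_of_subset_of_nonneg (Finset.subset_univ _)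
      fun i _ _ => qform_nonneg hρ.1 G i
  have hBl : B ≤ l⁻¹ := by
    rw [← one_div, le_div_iff₀ hl]
    linarith
  have hconj : ∀ (P Q : Matrix I I ℂ) i j,
      Complex.normSq ((Pᴴ * Q) i j) = Complex.normSq ((Qᴴ * P) j i) := by
    intro P Q i j
    have : Pᴴ * Q = (Qᴴ * P)ᴴ := by simp
    rw [this, Matrix.conjTranspose_apply, Complex.star_def, Complex.normSq_conj]
  have hmul : (Gᴴ * V) * (Vᴴ * U) = Gᴴ * U := by
    rw [Matrix.mul_assoc, ← Matrix.mul_assoc V, unitary_mul_conjTranspose ht.1, Matrix.one_mul]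
  have key := sum_weight_normSq_le (X := Gᴴ * V) (Y := Vᴴ * U)
    (mul_mem (conjTranspose_mem_unitary hG) ht.1) (mul_mem (conjTranspose_mem_unitary ht.1) hr.1)
    (hr.nonneg hρ.1) (ht.nonneg hω.1) hα hβ S
  rw [hmul] at key
  simp only [hconj G U, hconj V U, hconj G V, ← qform_eq hr, ← qform_eq ht] at key
  have := mul_le_mul_of_nonneg_left hBl (mul_nonneg zero_le_two (div_nonneg hα hβ.le))
  have := mul_nonneg hl.le hB0
  linarith

/-- Exponential moments of the spectra of `ρ` and `ω` with respect to `ρ`. -/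
def HasMoments (ρ ω : Matrix I I ℂ) (s x y : ℝ) : Prop :=
  ∃ U r V t, SpecDec ρ U r ∧ SpecDec ω V t ∧ (∀ i, 0 ≤ r i) ∧ (∀ j, 0 ≤ t j) ∧
    (∀ j, t j = 0 → qform ρ V j = 0) ∧ ∑ i, r i * r i ^ s = x ∧
    ∑ j, qform ρ V j * t j ^ (-s) = y

lemma HasMoments.trPos_le {ρ ω : Matrix I I ℂ} {s x y : ℝ} (h : HasMoments ρ ω s x y)
    (hρ : IsState ρ) (hω : IsState ω) (hs : 0 < s) {α β l : ℝ} (hα : 0 < α) (hβ : 0 < β)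
    (hl : 0 < l) :
    trPos (ρ - l • ω) ≤ x * α ^ (-s) + 2 * (y * β ^ s) + 2 * (α / β) * l⁻¹ := by
  obtain ⟨U, r, V, t, hr, ht, hr0, ht0, hsupp, hx, hy⟩ := h
  refine (trPos_sub_smul_le_tails hρ hω hr ht hα.le hβ hl).trans ?_
  have h1 : ∑ a, (if α < r a then r a else 0) ≤ x * α ^ (-s) := by
    rw [← hx, Finset.sum_mul]
    refine Finset.sum_le_sum fun a _ => ?_
    split_ifs with h
    · rw [mul_assoc]
      refine le_mul_of_one_le_right (hr0 a) ?_
      rw [Real.rpow_neg hα.le, ← div_eq_mul_inv, one_le_div (Real.rpow_pos_of_pos hα s)]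
      exact Real.rpow_le_rpow hα.le h.le hs.le
    · exact mul_nonneg (mul_nonneg (hr0 a) (Real.rpow_nonneg (hr0 a) _))
        (Real.rpow_nonneg hα.le _)
  have h2 : ∑ j, (if t j < β then qform ρ V j else 0) ≤ y * β ^ s := by
    rw [← hy, Finset.sum_mul]
    refine Finset.sum_le_sum fun j _ => ?_
    have hq := qform_nonneg hρ.1 V j
    split_ifs with h
    · rcases (ht0 j).eq_or_lt with h0 | h0
      · simp [hsupp j h0.symm]
      · rw [mul_assoc]
        refine le_mul_of_one_le_right hq ?_
        rw [Real.rpow_neg h0.le, inv_mul_eq_div, one_le_div (Real.rpow_pos_of_pos h0 s)]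
        exact Real.rpow_le_rpow h0.le h.le hs.le
    · exact mul_nonneg (mul_nonneg hq (Real.rpow_nonneg (ht0 j) _)) (Real.rpow_nonneg hβ.le _)
  linarith
lemma sum_fin_append {n m : ℕ} {β : Type*} [AddCommMonoid β] (f : (Fin (n + m) → I) → β) :
    ∑ z, f z = ∑ u : Fin n → I, ∑ v : Fin m → I, f (Fin.append u v) := by
  rw [← Equiv.sum_comp (Fin.appendEquiv n m), Fintype.sum_prod_type]
  rfl

lemma tprod_mul {n m : ℕ} (A B : Matrix (Fin n → I) (Fin n → I) ℂ)
    (C D : Matrix (Fin m → I) (Fin m → I) ℂ) :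
    tprod A C * tprod B D = tprod (A * B) (C * D) := by
  ext x y
  simp only [Matrix.mul_apply, sum_fin_append, tprod, Fin.append_left, Fin.append_right,
    Finset.sum_mul_sum]
  refine Finset.sum_congr rfl fun u _ => Finset.sum_congr rfl fun v _ => ?_
  ring

lemma tprod_conjTranspose {n m : ℕ} (A : Matrix (Fin n → I) (Fin n → I) ℂ)
    (C : Matrix (Fin m → I) (Fin m → I) ℂ) : (tprod A C)ᴴ = tprod Aᴴ Cᴴ := by
  ext x y
  simp [tprod, Matrix.conjTranspose_apply]

lemma fin_append_eta {n m : ℕ} (x : Fin (n + m) → I) :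
    Fin.append (fun i => x (Fin.castAdd m i)) (fun j => x (Fin.natAdd n j)) = x := by
  ext i
  refine Fin.addCases (fun j => ?_) (fun j => ?_) i <;> simp

lemma tprod_diagonal {n m : ℕ} (a : (Fin n → I) → ℂ) (b : (Fin m → I) → ℂ) :
    tprod (Matrix.diagonal a) (Matrix.diagonal b) = Matrix.diagonal (fun x =>
      a (fun i => x (Fin.castAdd m i)) * b (fun j => x (Fin.natAdd n j))) := by
  ext x y
  by_cases h : x = y
  · subst h
    simp [tprod]
  · rw [Matrix.diagonal_apply_ne _ h, tprod]
    by_cases h1 : (fun i => x (Fin.castAdd m i)) = (fun i => y (Fin.castAdd m i))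
    · rw [Matrix.diagonal_apply_ne b, mul_zero]
      intro h2
      apply h
      rw [← fin_append_eta x, ← fin_append_eta y, h1, h2]
    · rw [Matrix.diagonal_apply_ne a h1, zero_mul]

lemma tprod_one {n m : ℕ} : tprod (1 : Matrix (Fin n → I) (Fin n → I) ℂ)
    (1 : Matrix (Fin m → I) (Fin m → I) ℂ) = 1 := by
  rw [← Matrix.diagonal_one, ← Matrix.diagonal_one, tprod_diagonal]
  simp

lemma SpecDec.tprod {n m : ℕ} {A U : Matrix (Fin n → I) (Fin n → I) ℂ} {a : (Fin n → I) → ℝ}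
    {B V : Matrix (Fin m → I) (Fin m → I) ℂ} {b : (Fin m → I) → ℝ} (hA : SpecDec A U a)
    (hB : SpecDec B V b) : SpecDec (GQSL.tprod A B) (GQSL.tprod U V)
      (fun x => a (fun i => x (Fin.castAdd m i)) * b (fun j => x (Fin.natAdd n j))) := by
  constructor
  · rw [Matrix.mem_unitaryGroup_iff, Matrix.star_eq_conjTranspose, tprod_conjTranspose, tprod_mul,
      unitary_mul_conjTranspose hA.1, unitary_mul_conjTranspose hB.1, tprod_one]
  · push_cast
    rw [← tprod_diagonal (fun i => (a i : ℂ)) (fun i => (b i : ℂ)), tprod_conjTranspose,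
      tprod_mul, tprod_mul, ← hA.2, ← hB.2]

lemma coe_qform {A : Matrix I I ℂ} (hA : A.IsHermitian) (U : Matrix I I ℂ) (i : I) :
    (Uᴴ * A * U) i i = (qform A U i : ℂ) := by
  have h := Matrix.isHermitian_conjTranspose_mul_mul U hA
  exact (h.coe_re_apply_self i).symm

lemma qform_tprod {n m : ℕ} {A : Matrix (Fin n → I) (Fin n → I) ℂ}
    {B : Matrix (Fin m → I) (Fin m → I) ℂ} (hA : A.IsHermitian) (hB : B.IsHermitian)
    (U : Matrix (Fin n → I) (Fin n → I) ℂ) (V : Matrix (Fin m → I) (Fin m → I) ℂ)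
    (x : Fin (n + m) → I) :
    qform (tprod A B) (tprod U V) x = qform A U (fun i => x (Fin.castAdd m i)) *
      qform B V (fun j => x (Fin.natAdd n j)) := by
  rw [qform, tprod_conjTranspose, tprod_mul, tprod_mul, tprod, coe_qform hA, coe_qform hB,
    ← Complex.ofReal_mul, Complex.ofReal_re]

lemma HasMoments.tprod {n m : ℕ} {A W : Matrix (Fin n → I) (Fin n → I) ℂ}
    {B Z : Matrix (Fin m → I) (Fin m → I) ℂ} {s x y x' y' : ℝ} (h : HasMoments A W s x y)
    (h' : HasMoments B Z s x' y') :
    HasMoments (GQSL.tprod A B) (GQSL.tprod W Z) s (x * x') (y * y') := by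
  obtain ⟨U, r, V, t, hr, ht, hr0, ht0, hsupp, hx, hy⟩ := h
  obtain ⟨U', r', V', t', hr', ht', hr0', ht0', hsupp', hx', hy'⟩ := h'
  have hq := qform_tprod hr.isHermitian hr'.isHermitian V V'
  refine ⟨_, _, _, _, hr.tprod hr', ht.tprod ht', fun i => mul_nonneg (hr0 _) (hr0' _),
    fun i => mul_nonneg (ht0 _) (ht0' _), fun j hj => ?_, ?_, ?_⟩
  · rw [hq]
    rcases mul_eq_zero.1 hj with h | h
    · rw [hsupp _ h, zero_mul]
    · rw [hsupp' _ h, mul_zero]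
  · rw [← hx, ← hx', Finset.sum_mul_sum, sum_fin_append]
    refine Finset.sum_congr rfl fun u _ => Finset.sum_congr rfl fun v _ => ?_
    simp only [Fin.append_left, Fin.append_right]
    rw [Real.mul_rpow (hr0 _) (hr0' _)]
    ring
  · rw [← hy, ← hy', Finset.sum_mul_sum, sum_fin_append]
    refine Finset.sum_congr rfl fun u _ => Finset.sum_congr rfl fun v _ => ?_
    rw [hq]
    simp only [Fin.append_left, Fin.append_right]
    rw [Real.mul_rpow (ht0 _) (ht0' _)]
    ring

lemma tpow_add (ρ : Matrix I I ℂ) (n m : ℕ) : tpow ρ (n + m) = tprod (tpow ρ n) (tpow ρ m) := by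
  ext x y
  simp [tpow, tprod, Fin.prod_univ_add]

lemma tpow_mul (A B : Matrix I I ℂ) (n : ℕ) : tpow A n * tpow B n = tpow (A * B) n := by
  ext x y
  simp only [Matrix.mul_apply, tpow, ← Finset.prod_mul_distrib]
  rw [Finset.prod_univ_sum]
  simp

lemma tpow_conjTranspose (A : Matrix I I ℂ) (n : ℕ) : (tpow A n)ᴴ = tpow Aᴴ n := by
  ext x y
  simp [tpow, Matrix.conjTranspose_apply]

lemma tpow_diagonal (a : I → ℂ) (n : ℕ) :
    tpow (Matrix.diagonal a) n = Matrix.diagonal (fun x => ∏ i, a (x i)) := by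
  ext x y
  by_cases h : x = y
  · subst h
    simp [tpow]
  · rw [Matrix.diagonal_apply_ne _ h, tpow]
    obtain ⟨i, hi⟩ := Function.ne_iff.1 h
    exact Finset.prod_eq_zero (Finset.mem_univ i) (Matrix.diagonal_apply_ne _ hi)

lemma SpecDec.tpow {A U : Matrix I I ℂ} {a : I → ℝ} (h : SpecDec A U a) (n : ℕ) :
    SpecDec (GQSL.tpow A n) (GQSL.tpow U n) (fun x => ∏ i, a (x i)) := by
  constructor
  · rw [Matrix.mem_unitaryGroup_iff, Matrix.star_eq_conjTranspose, tpow_conjTranspose, tpow_mul,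
      unitary_mul_conjTranspose h.1, ← Matrix.diagonal_one, tpow_diagonal]
    simp
  · push_cast
    rw [← tpow_diagonal (fun i => (a i : ℂ)), tpow_conjTranspose, tpow_mul, tpow_mul, ← h.2]

lemma SpecDec.posSemidef {A U : Matrix I I ℂ} {a : I → ℝ} (h : SpecDec A U a)
    (ha : ∀ i, 0 ≤ a i) : A.PosSemidef := by
  rw [h.2]
  refine Matrix.PosSemidef.mul_mul_conjTranspose_same ?_ U
  exact Matrix.PosSemidef.diagonal fun i => by simpa using ha i

lemma isState_tpow {ρ : Matrix I I ℂ} (hρ : IsState ρ) (n : ℕ) : IsState (tpow ρ n) := by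
  obtain ⟨U, a, h⟩ := exists_specDec hρ.1.1
  refine ⟨(h.tpow n).posSemidef fun x => Finset.prod_nonneg fun i _ => h.nonneg hρ.1 _, ?_⟩
  have h1 : (tpow ρ n).trace = ∏ _i : Fin n, ρ.trace := by
    simp only [Matrix.trace, tpow, Matrix.diag_apply]
    rw [Finset.prod_univ_sum]
    simp
  simp [h1, hρ.2]

lemma qform_eq_zero_of_suppLe {ρ ω V : Matrix I I ℂ} {t : I → ℝ} (h : SuppLe ρ ω)
    (ht : SpecDec ω V t) {j : I} (hj : t j = 0) : qform ρ V j = 0 := by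
  have h1 : ω *ᵥ (V.col j) = 0 := by
    have : ω * V = V * Matrix.diagonal (fun i => (t i : ℂ)) := by
      conv_lhs => rw [ht.2]
      rw [Matrix.mul_assoc, unitary_conjTranspose_mul ht.1, Matrix.mul_one]
    ext i
    have h2 := congrFun (congrFun this i) j
    rw [Matrix.mul_diagonal, hj, Complex.ofReal_zero, mul_zero] at h2
    exact h2
  have h2 := h _ h1
  rw [qform, Matrix.mul_assoc, Matrix.mul_apply]
  have h3 : ∀ i, (ρ * V) i j = 0 := fun i => congrFun h2 i
  simp [h3]

lemma hasMoments_of_suppLe {ρ ω U V : Matrix I I ℂ} {r t : I → ℝ} (hρ : IsState ρ)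
    (hω : IsState ω) (h : SuppLe ρ ω) (hr : SpecDec ρ U r) (ht : SpecDec ω V t) (s : ℝ) :
    HasMoments ρ ω s (∑ i, r i * r i ^ s) (∑ j, qform ρ V j * t j ^ (-s)) :=
  ⟨U, r, V, t, hr, ht, hr.nonneg hρ.1, ht.nonneg hω.1,
    fun _ hj => qform_eq_zero_of_suppLe h ht hj, rfl, rfl⟩

lemma suppLe_of_pos (ρ : Matrix I I ℂ) {ω V : Matrix I I ℂ} {t : I → ℝ} (ht : SpecDec ω V t)
    (h0 : ∀ i, 0 < t i) : SuppLe ρ ω := by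
  intro v hv
  have h1 : V * Matrix.diagonal (fun i => ((t i)⁻¹ : ℂ)) * Vᴴ * ω = 1 := by
    calc V * Matrix.diagonal (fun i => ((t i)⁻¹ : ℂ)) * Vᴴ * ω
        = V * (Matrix.diagonal (fun i => ((t i)⁻¹ : ℂ)) * ((Vᴴ * V) *
            Matrix.diagonal (fun i => (t i : ℂ)))) * Vᴴ := by
          rw [ht.2]
          simp only [Matrix.mul_assoc]
      _ = 1 := by
          have h2 : ∀ i, ((t i : ℂ))⁻¹ * (t i : ℂ) = 1 := fun i =>
            inv_mul_cancel₀ (by exact_mod_cast (h0 i).ne')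
          rw [unitary_conjTranspose_mul ht.1, Matrix.one_mul, Matrix.diagonal_mul_diagonal]
          simp only [h2, Matrix.diagonal_one, Matrix.mul_one, unitary_mul_conjTranspose ht.1]
  have h2 : v = 0 := by
    rw [← Matrix.one_mulVec v, ← h1, ← Matrix.mulVec_mulVec, hv, Matrix.mulVec_zero]
  rw [h2, Matrix.mulVec_zero]

lemma exists_specDec_pos {A : Matrix I I ℂ} (hA : A.PosDef) :
    ∃ U a, SpecDec A U a ∧ ∀ i, 0 < a i := by
  refine ⟨hA.1.eigenvectorUnitary.1, hA.1.eigenvalues, ⟨hA.1.eigenvectorUnitary.2, ?_⟩,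
    hA.eigenvalues_pos⟩
  have h := hA.1.spectral_theorem
  rw [Unitary.conjStarAlgAut_apply] at h
  exact h

/-- A random variable of negative mean has a small exponential moment below one. -/
lemma eventually_sum_mul_rpow_lt_one {p z : I → ℝ} (hp : ∑ i, p i = 1)
    (hz : ∑ i, p i * z i < 0) :
    ∀ᶠ s in nhdsWithin (0 : ℝ) (Set.Ioi 0), ∑ i, p i * (2 : ℝ) ^ (s * z i) < 1 := by
  have hd : HasDerivAt (fun s : ℝ => ∑ i, p i * (2 : ℝ) ^ (s * z i))
      (∑ i, p i * (Real.log 2 * z i)) 0 := by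
    refine HasDerivAt.fun_sum fun i _ => ?_
    have h1 : HasDerivAt (fun s : ℝ => s * z i) (z i) 0 := by
      simpa using (hasDerivAt_id (0 : ℝ)).mul_const (z i)
    have h2 := (h1.const_rpow (a := 2) (by norm_num)).const_mul (p i)
    simpa using h2
  have hneg : ∑ i, p i * (Real.log 2 * z i) < 0 := by
    have : ∑ i, p i * (Real.log 2 * z i) = Real.log 2 * ∑ i, p i * z i := by
      rw [Finset.mul_sum]
      exact Finset.sum_congr rfl fun i _ => by ring
    rw [this]
    exact mul_neg_of_pos_of_neg (Real.log_pos one_lt_two) hz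
  have ht := hd.tendsto_slope_zero_right
  filter_upwards [ht.eventually (gt_mem_nhds hneg), self_mem_nhdsWithin] with s hs hs0
  simp only [zero_add, zero_mul, Real.rpow_zero, mul_one, hp, smul_eq_mul] at hs
  by_contra hcon
  have : 0 ≤ s⁻¹ * (∑ i, p i * (2 : ℝ) ^ (s * z i) - 1) :=
    mul_nonneg (inv_nonneg.2 (le_of_lt hs0)) (by linarith)
  linarith

lemma tendsto_atTop_of_residues {f : ℕ → ℝ} {k : ℕ} (hk : 0 < k) {l : ℝ}
    (h : ∀ r < k, Tendsto (fun m => f (r + m * k)) atTop (nhds l)) :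
    Tendsto f atTop (nhds l) := by
  rw [Metric.tendsto_atTop]
  intro ε hε
  have h' : ∀ᶠ m in atTop, ∀ r ∈ Finset.range k, dist (f (r + m * k)) l < ε := by
    rw [Filter.eventually_all_finset]
    intro r hr
    exact (h r (Finset.mem_range.1 hr)).eventually (Metric.ball_mem_nhds l hε)
  obtain ⟨m₀, hm⟩ := eventually_atTop.1 h'
  refine ⟨m₀ * k, fun n hn => ?_⟩
  have := hm (n / k) ((Nat.le_div_iff_mul_le hk).2 hn) (n % k)
    (Finset.mem_range.2 (Nat.mod_lt n hk))
  rwa [mul_comm, Nat.mod_add_div] at this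
lemma rpow_log_weight {r s c : ℝ} (hr : 0 ≤ r) :
    r * (2 : ℝ) ^ (s * (Real.logb 2 r + c)) = r * r ^ s * (2 : ℝ) ^ (s * c) := by
  rcases hr.eq_or_lt with h | h
  · simp [← h]
  · rw [mul_add, Real.rpow_add two_pos, mul_comm s (Real.logb 2 r), Real.rpow_mul zero_le_two,
      Real.rpow_logb two_pos (by norm_num) h]
    ring

section Family

variable {d : ℕ} {σ : Matrix (Fin d) (Fin d) ℂ}
  {M : ∀ n : ℕ, Set (Matrix (Fin n → Fin d) (Fin n → Fin d) ℂ)}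

lemma GoodFamily.suppLe_tpow (hM : GoodFamily σ M) {n : ℕ}
    (A : Matrix (Fin n → Fin d) (Fin n → Fin d) ℂ) : SuppLe A (tpow σ n) := by
  obtain ⟨U, a, h, h0⟩ := exists_specDec_pos hM.sigma_posdef
  exact suppLe_of_pos A (h.tpow n) fun x => Finset.prod_pos fun i _ => h0 _

/-- Powers of a fixed member of the family, padded with copies of `σ`, have multiplicative
exponential moments. -/
lemma GoodFamily.exists_hasMoments (hM : GoodFamily σ M) {ρ : Matrix (Fin d) (Fin d) ℂ}
    (hρ : IsState ρ) {k : ℕ} {ω : Matrix (Fin k → Fin d) (Fin k → Fin d) ℂ} (hω : ω ∈ M k)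
    {s x y : ℝ} (h : HasMoments (tpow ρ k) ω s x y) (r : ℕ) :
    ∃ X Y : ℝ, ∀ m : ℕ, ∃ W ∈ M (r + m * k),
      HasMoments (tpow ρ (r + m * k)) W s (X * x ^ m) (Y * y ^ m) := by
  obtain ⟨U, a, ha⟩ := exists_specDec (isState_tpow hρ r).1.1
  have hσ := hM.states r _ (hM.sigma_mem r)
  obtain ⟨V, t, ht⟩ := exists_specDec hσ.1.1
  refine ⟨∑ i, a i * a i ^ s, ∑ j, qform (tpow ρ r) V j * t j ^ (-s), fun m => ?_⟩
  induction m with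
  | zero =>
    have e : r + 0 * k = r := by ring
    rw [e, pow_zero, pow_zero, mul_one, mul_one]
    exact ⟨_, hM.sigma_mem r,
      hasMoments_of_suppLe (isState_tpow hρ r) hσ (hM.suppLe_tpow _) ha ht s⟩
  | succ m ih =>
    obtain ⟨W, hW, hmom⟩ := ih
    have e : r + (m + 1) * k = (r + m * k) + k := by ring
    rw [e, tpow_add, pow_succ, pow_succ, ← mul_assoc, ← mul_assoc]
    exact ⟨_, hM.tprod_mem _ _ _ hW _ hω, hmom.tprod h⟩

lemma GoodFamily.nonneg_of_mem_testSet (hM : GoodFamily σ M) {ρ : Matrix (Fin d) (Fin d) ℂ}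
    (hρ : IsState ρ) {n : ℕ} {l x : ℝ}
    (hx : x ∈ {x : ℝ | ∃ ω ∈ M n, x = trPos (tpow ρ n - l • ω)}) : 0 ≤ x := by
  obtain ⟨ω, hω, rfl⟩ := hx
  exact trPos_nonneg (isHermitian_sub_smul (isState_tpow hρ n).1.1 (hM.states n _ hω).1.1 _)

lemma GoodFamily.sInf_le_trPos (hM : GoodFamily σ M) {ρ : Matrix (Fin d) (Fin d) ℂ}
    (hρ : IsState ρ) {n : ℕ} {l : ℝ} {ω : Matrix (Fin n → Fin d) (Fin n → Fin d) ℂ}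
    (hω : ω ∈ M n) :
    sInf {x : ℝ | ∃ ω ∈ M n, x = trPos (tpow ρ n - l • ω)} ≤ trPos (tpow ρ n - l • ω) :=
  csInf_le ⟨0, fun _ hx => hM.nonneg_of_mem_testSet hρ hx⟩ ⟨ω, hω, rfl⟩

lemma GoodFamily.exists_relEnt_lt (hM : GoodFamily σ M) {n : ℕ}
    {A : Matrix (Fin n → Fin d) (Fin n → Fin d) ℂ} {c : ℝ} (h : EMset (M n) A < c) :
    ∃ ω ∈ M n, SuppLe A ω ∧ relEnt A ω < c := by
  obtain ⟨_, ⟨ω, hω, hs, rfl⟩, hlt⟩ := exists_lt_of_csInf_lt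
    (s := {x | ∃ σ ∈ M n, SuppLe A σ ∧ x = relEnt A σ})
    ⟨_, tpow σ n, hM.sigma_mem n, hM.suppLe_tpow A, rfl⟩ h
  exact ⟨ω, hω, hs, hlt⟩

/-- Strong converse: above the regularized relative entropy the optimal value vanishes. -/
lemma GoodFamily.tendsto_zero (hM : GoodFamily σ M) {ρ : Matrix (Fin d) (Fin d) ℂ}
    (hρ : IsState ρ) {E : ℝ}
    (hE : Tendsto (fun n : ℕ => EMset (M n) (tpow ρ n) / n) atTop (nhds E))
    {y : ℝ} (hy : E < y) :
    Tendsto (fun n : ℕ =>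
      sInf {x : ℝ | ∃ ω ∈ M n, x = trPos (tpow ρ n - ((2 : ℝ) ^ (y * (n : ℝ))) • ω)})
      atTop (nhds 0) := by
  obtain ⟨k, hk1, hk⟩ := ((hE.eventually (gt_mem_nhds (show E < (E + y) / 2 by linarith))).and
    (eventually_gt_atTop 0)).exists
  have hk' : (0 : ℝ) < k := by exact_mod_cast hk
  rw [div_lt_iff₀ hk'] at hk1
  obtain ⟨ω, hω, hsupp, hlt⟩ := hM.exists_relEnt_lt hk1
  have hρk := isState_tpow hρ k
  have hωs := hM.states k ω hω
  obtain ⟨U, r, hr⟩ := exists_specDec hρk.1.1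
  obtain ⟨V, t, ht⟩ := exists_specDec hωs.1.1
  have hr0 := hr.nonneg hρk.1
  have ht0 := ht.nonneg hωs.1
  rw [relEnt_eq hr ht hr0 ht0] at hlt
  set H := ∑ i, r i * Real.logb 2 (r i) with hH
  set L := ∑ j, qform (tpow ρ k) V j * Real.logb 2 (t j) with hL
  set γ := (y - E) / 8 * k with hγ
  have hγ0 : 0 < γ := by
    have : 0 < y - E := by linarith
    positivity
  have hq1 : ∑ j, qform (tpow ρ k) V j = 1 := by rw [sum_qform ht.1, hρk.2, Complex.one_re]
  have hz1 : ∑ i, r i * (Real.logb 2 (r i) + (-H - γ)) < 0 := by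
    simp only [mul_add, Finset.sum_add_distrib, ← Finset.sum_mul, hr.sum_eq_one hρk]
    linarith
  have hz2 : ∑ j, qform (tpow ρ k) V j * (-Real.logb 2 (t j) + (L - γ)) < 0 := by
    simp only [mul_add, mul_neg, Finset.sum_add_distrib, Finset.sum_neg_distrib,
      ← Finset.sum_mul, hq1]
    linarith
  obtain ⟨s, ⟨hs1, hs2⟩, hs⟩ := (((eventually_sum_mul_rpow_lt_one (hr.sum_eq_one hρk) hz1).and
    (eventually_sum_mul_rpow_lt_one hq1 hz2)).and self_mem_nhdsWithin).exists
  replace hs : 0 < s := hs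
  set A : ℝ := (2 : ℝ) ^ (H + γ) with hA
  set B : ℝ := (2 : ℝ) ^ (L - γ) with hB
  have hA0 : 0 < A := Real.rpow_pos_of_pos two_pos _
  have hB0 : 0 < B := Real.rpow_pos_of_pos two_pos _
  set x := ∑ i, r i * r i ^ s with hx
  set w := ∑ j, qform (tpow ρ k) V j * t j ^ (-s) with hw
  have hx1 : x * A ^ (-s) < 1 := by
    convert hs1 using 1
    rw [hx, Finset.sum_mul]
    refine Finset.sum_congr rfl fun i _ => ?_
    rw [rpow_log_weight (hr0 i), hA, ← Real.rpow_mul zero_le_two]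
    congr 2
    ring
  have hw1 : w * B ^ s < 1 := by
    convert hs2 using 1
    rw [hw, Finset.sum_mul]
    refine Finset.sum_congr rfl fun j _ => ?_
    rcases (ht0 j).eq_or_lt with h | h
    · simp [qform_eq_zero_of_suppLe hsupp ht h.symm]
    · rw [mul_add, Real.rpow_add two_pos, mul_neg, ← neg_mul, mul_comm (-s) (Real.logb 2 (t j)),
        Real.rpow_mul zero_le_two, Real.rpow_logb two_pos (by norm_num) h, hB,
        ← Real.rpow_mul zero_le_two, mul_comm s, mul_assoc]
  have hx0 : 0 ≤ x * A ^ (-s) := mul_nonneg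
    (Finset.sum_nonneg fun i _ => mul_nonneg (hr0 i) (Real.rpow_nonneg (hr0 i) _))
    (Real.rpow_nonneg hA0.le _)
  have hw0 : 0 ≤ w * B ^ s := mul_nonneg
    (Finset.sum_nonneg fun j _ => mul_nonneg (qform_nonneg hρk.1 V j)
      (Real.rpow_nonneg (ht0 j) _)) (Real.rpow_nonneg hB0.le _)
  set C : ℝ := A / B * ((2 : ℝ) ^ (y * k))⁻¹ with hC
  have hC0 : 0 ≤ C := by positivity
  have hC1 : C < 1 := by
    rw [hC, hA, hB, ← Real.rpow_sub two_pos, ← Real.rpow_neg zero_le_two,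
      ← Real.rpow_add two_pos]
    refine Real.rpow_lt_one_of_one_lt_of_neg one_lt_two ?_
    rw [hγ]
    nlinarith [mul_pos (show 0 < y - E by linarith) hk']
  refine tendsto_atTop_of_residues hk fun q _ => ?_
  obtain ⟨X, Y, hXY⟩ := hM.exists_hasMoments hρ hω
    (hasMoments_of_suppLe hρk hωs hsupp hr ht s) q
  have hlim : Tendsto (fun m : ℕ => X * (x * A ^ (-s)) ^ m + 2 * (Y * (w * B ^ s) ^ m) +
      2 * (((2 : ℝ) ^ (y * q))⁻¹ * C ^ m)) atTop (nhds 0) := by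
    have t1 := (tendsto_pow_atTop_nhds_zero_of_lt_one hx0 hx1).const_mul X
    have t2 := ((tendsto_pow_atTop_nhds_zero_of_lt_one hw0 hw1).const_mul Y).const_mul 2
    have t3 := ((tendsto_pow_atTop_nhds_zero_of_lt_one hC0 hC1).const_mul
      ((2 : ℝ) ^ (y * q))⁻¹).const_mul 2
    simpa using (t1.add t2).add t3
  refine squeeze_zero (fun m => Real.sInf_nonneg fun _ hx => hM.nonneg_of_mem_testSet hρ hx)
    (fun m => ?_) hlim
  obtain ⟨W, hW, hmom⟩ := hXY m
  refine (hM.sInf_le_trPos hρ hW).trans ((hmom.trPos_le (isState_tpow hρ _) (hM.states _ _ hW) hs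
    (pow_pos hA0 m) (pow_pos hB0 m) (Real.rpow_pos_of_pos two_pos _)).trans (le_of_eq ?_))
  have e1 : ∀ {b : ℝ} (u : ℝ), 0 < b → (b ^ m) ^ u = (b ^ u) ^ m := by
    intro b u hb
    rw [← Real.rpow_natCast, ← Real.rpow_natCast, ← Real.rpow_mul hb.le, ← Real.rpow_mul hb.le,
      mul_comm]
  have e2 : (2 : ℝ) ^ (y * ((q + m * k : ℕ) : ℝ)) = 2 ^ (y * q) * (2 ^ (y * k)) ^ m := by
    rw [← Real.rpow_natCast (_ ^ (y * (k : ℝ))), ← Real.rpow_mul zero_le_two,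
      ← Real.rpow_add two_pos]
    congr 1
    push_cast
    ring
  rw [e1 _ hA0, e1 _ hB0, e2, hC, mul_pow, mul_pow, mul_pow, div_pow, inv_pow, mul_inv]
  ring

end Family

/-- A Hermitian matrix can be diagonalized inside each block of a partition of the index set. -/
lemma exists_block_unitary {κ : Type*} [Fintype κ] [DecidableEq κ] (k : I → κ)
    {A : Matrix I I ℂ} (hA : A.IsHermitian) :
    ∃ B ∈ Matrix.unitaryGroup I ℂ, (∀ i j, k i ≠ k j → B i j = 0) ∧
      ∀ i j, i ≠ j → k i = k j → (Bᴴ * A * B) i j = 0 := by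
  have hR : ∀ c, (A.submatrix (Subtype.val : {x // k x = c} → I) Subtype.val).IsHermitian :=
    fun c => hA.submatrix _
  choose W a hW using fun c => exists_specDec (hR c)
  set e := (Equiv.sigmaFiberEquiv k).symm with he
  set B : Matrix I I ℂ := (Matrix.blockDiagonal' W).submatrix e e with hB
  set P : Matrix I I ℂ := (Matrix.blockDiagonal' fun c =>
    A.submatrix (Subtype.val : {x // k x = c} → I) Subtype.val).submatrix e e with hP
  have hB0 : ∀ i j, k i ≠ k j → B i j = 0 := by
    intro i j hij
    rw [hB, Matrix.submatrix_apply, Matrix.blockDiagonal'_apply, dif_neg]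
    exact hij
  have hP1 : ∀ i j, k i = k j → P i j = A i j := by
    intro i j hij
    rw [hP, Matrix.submatrix_apply, Matrix.blockDiagonal'_apply, dif_pos (show (e i).1 = (e j).1
      from hij), Matrix.submatrix_apply]
    congr 1
    have : ∀ (c c' : κ) (h : c = c') (x : {x // k x = c}),
        (cast (congrArg (fun c => {x // k x = c}) h) x).val = x.val := by
      rintro c _ rfl x
      rfl
    exact this _ _ hij.symm (e j).2
  have hBh : Bᴴ = (Matrix.blockDiagonal' fun c => (W c)ᴴ).submatrix e e := by
    rw [hB, Matrix.conjTranspose_submatrix, Matrix.blockDiagonal'_conjTranspose]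
  refine ⟨B, ?_, hB0, ?_⟩
  · rw [Matrix.mem_unitaryGroup_iff, Matrix.star_eq_conjTranspose, hBh, hB,
      Matrix.submatrix_mul_equiv, ← Matrix.blockDiagonal'_mul]
    simp only [fun c => unitary_mul_conjTranspose (hW c).1]
    rw [show (fun c => (1 : Matrix {x // k x = c} {x // k x = c} ℂ)) = 1 from rfl,
      Matrix.blockDiagonal'_one, Matrix.submatrix_one_equiv]
  · intro i j hij hk
    have h1 : (Bᴴ * A * B) i j = (Bᴴ * P * B) i j := by
      simp only [Matrix.mul_apply, Finset.sum_mul, Matrix.conjTranspose_apply]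
      refine Finset.sum_congr rfl fun x _ => Finset.sum_congr rfl fun z _ => ?_
      by_cases hx : k x = k j
      · by_cases hz : k z = k i
        · rw [hP1 z x (by rw [hz, hx, hk])]
        · simp [hB0 z i hz]
      · simp [hB0 x j hx]
    have h2 : Bᴴ * P * B = (Matrix.diagonal fun x : (Σ c, {x // k x = c}) =>
        ((a x.1 x.2 : ℝ) : ℂ)).submatrix e e := by
      rw [hBh, hP, hB, Matrix.submatrix_mul_equiv, Matrix.submatrix_mul_equiv,
        ← Matrix.blockDiagonal'_mul, ← Matrix.blockDiagonal'_mul,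
        ← Matrix.blockDiagonal'_diagonal fun c x => ((a c x : ℝ) : ℂ)]
      congr 2
      ext1 c
      rw [(hW c).2]
      simp only [Matrix.mul_assoc, unitary_conjTranspose_mul (hW c).1, Matrix.mul_one]
      rw [← Matrix.mul_assoc, unitary_conjTranspose_mul (hW c).1, Matrix.one_mul]
    rw [h1, h2, Matrix.submatrix_apply, Matrix.diagonal_apply_ne]
    exact fun h => hij (e.injective h)

/-- Bessel's inequality for orthogonal rows, tested on a basis vector. -/
lemma sum_normSq_div_le_one {W : Matrix I I ℂ} {p : I → ℝ} {S : Finset I}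
    (hp : ∀ i ∈ S, 0 < p i) (hd : ∀ i ∈ S, (W * Wᴴ) i i = (p i : ℂ))
    (ho : ∀ i ∈ S, ∀ j ∈ S, i ≠ j → (W * Wᴴ) i j = 0) (a : I) :
    ∑ i ∈ S, Complex.normSq (W i a) / p i ≤ 1 := by
  set c : I → ℝ := fun i => if i ∈ S then (Real.sqrt (p i))⁻¹ else 0 with hc
  set D : Matrix I I ℂ := Matrix.diagonal (fun i => (c i : ℂ)) * W with hD
  set χ : Matrix I I ℂ := Matrix.diagonal (fun i => if i ∈ S then 1 else 0) with hχ
  have hDD : D * Dᴴ = χ := by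
    have h1 : D * Dᴴ = Matrix.diagonal (fun i => (c i : ℂ)) * (W * Wᴴ) *
        Matrix.diagonal (fun i => (c i : ℂ)) := by
      rw [hD, Matrix.conjTranspose_mul, Matrix.diagonal_conjTranspose]
      have : star (fun i => (c i : ℂ)) = fun i => (c i : ℂ) := by
        ext i
        simp
      rw [this]
      simp only [Matrix.mul_assoc]
    ext i j
    rw [h1, Matrix.mul_diagonal, Matrix.diagonal_mul, hχ]
    by_cases hi : i ∈ S
    · by_cases hj : j ∈ S
      · by_cases hij : i = j
        · subst hij
          rw [hd i hi, Matrix.diagonal_apply_eq, if_pos hi, hc]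
          simp only [if_pos hi]
          have := Real.mul_self_sqrt (hp i hi).le
          have h0 := (Real.sqrt_pos.2 (hp i hi)).ne'
          norm_cast
          field_simp
          rw [pow_two, this]
        · rw [ho i hi j hj hij, Matrix.diagonal_apply_ne _ hij]
          simp
      · have hij : i ≠ j := fun h => hj (h ▸ hi)
        rw [Matrix.diagonal_apply_ne _ hij]
        simp [hc, hj]
    · by_cases hij : i = j
      · subst hij
        simp [hc, hi]
      · rw [Matrix.diagonal_apply_ne _ hij]
        simp [hc, hi]
  have hχD : χ * D = D := by
    ext i j
    rw [hχ, Matrix.diagonal_mul, hD, Matrix.diagonal_mul]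
    by_cases hi : i ∈ S <;> simp [hc, hi]
  set Q := Dᴴ * D with hQ
  have hQQ : Q * Qᴴ = Q := by
    have hQh : Qᴴ = Q := Matrix.isHermitian_conjTranspose_mul_self D
    rw [hQh, hQ, Matrix.mul_assoc, ← Matrix.mul_assoc D, hDD, hχD]
  have hval : Q a a = ((∑ i ∈ S, Complex.normSq (W i a) / p i : ℝ) : ℂ) := by
    rw [hQ, Matrix.mul_apply, Complex.ofReal_sum, ← Finset.sum_filter_add_sum_filter_not
      Finset.univ (· ∈ S)]
    rw [Finset.sum_eq_zero (s := Finset.univ.filter (fun i => i ∉ S)), add_zero,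
      Finset.filter_mem_eq_inter, Finset.univ_inter]
    · refine Finset.sum_congr rfl fun i hi => ?_
      rw [Matrix.conjTranspose_apply, Complex.star_def, ← Complex.normSq_eq_conj_mul_self, hD,
        Matrix.diagonal_mul, Complex.normSq_mul, Complex.normSq_ofReal, hc]
      simp only [if_pos hi]
      rw [← mul_inv, Real.mul_self_sqrt (hp i hi).le, div_eq_inv_mul]
    · intro i hi
      simp only [Finset.mem_filter, Finset.mem_univ, true_and] at hi
      simp [hD, Matrix.diagonal_mul, hc, hi]
  set x := ∑ i ∈ S, Complex.normSq (W i a) / p i with hx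
  have hsq : x * x ≤ x := by
    have h1 : ((∑ b, Complex.normSq (Q a b) : ℝ) : ℂ) = (x : ℂ) := by
      rw [← hval, ← congrFun (congrFun hQQ a) a, Matrix.mul_apply, Complex.ofReal_sum]
      refine Finset.sum_congr rfl fun b _ => ?_
      rw [Matrix.conjTranspose_apply, Complex.star_def, Complex.mul_conj]
    have h2 : ∑ b, Complex.normSq (Q a b) = x := by exact_mod_cast h1
    calc x * x = Complex.normSq (Q a a) := by rw [hval, Complex.normSq_ofReal]
      _ ≤ ∑ b, Complex.normSq (Q a b) :=
        Finset.single_le_sum (f := fun b => Complex.normSq (Q a b))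
          (fun b _ => Complex.normSq_nonneg _) (Finset.mem_univ a)
      _ = x := h2
  nlinarith

/-- Measuring in a basis that diagonalizes `ρ` inside each of `v` blocks increases the entropy by
at most `log v`. -/
lemma sum_mul_log_le_of_blocks {κ : Type*} [Fintype κ] [Nonempty κ] [DecidableEq κ] (k : I → κ)
    {ρ U e : Matrix I I ℂ} {r : I → ℝ} (hρ : IsState ρ) (hr : SpecDec ρ U r)
    (he : e ∈ Matrix.unitaryGroup I ℂ)
    (ho : ∀ i j, i ≠ j → k i = k j → (eᴴ * ρ * e) i j = 0) :
    ∑ a, r a * Real.log (r a) ≤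
      Real.log (Fintype.card κ) + ∑ i, qform ρ e i * Real.log (qform ρ e i) := by
  have hr0 := hr.nonneg hρ.1
  set v : ℝ := (Fintype.card κ : ℝ) with hv
  have hv0 : 0 < v := by
    rw [hv]
    exact_mod_cast Fintype.card_pos
  set p := qform ρ e with hp
  have hp0 : ∀ i, 0 ≤ p i := qform_nonneg hρ.1 e
  set O := eᴴ * U with hO
  have hOu : O ∈ Matrix.unitaryGroup I ℂ := mul_mem (conjTranspose_mem_unitary he) hr.1
  set N : I → I → ℝ := fun i a => Complex.normSq (O i a) with hN
  have hN0 : ∀ i a, 0 ≤ N i a := fun i a => Complex.normSq_nonneg _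
  have hcol : ∀ a, ∑ i, N i a = 1 := sum_normSq_col hOu
  have hpN : ∀ i, p i = ∑ a, N i a * r a := by
    intro i
    rw [hp, qform_eq hr]
    refine Finset.sum_congr rfl fun a _ => ?_
    have : (Uᴴ * e) a i = star (O i a) := by
      rw [hO, ← Matrix.conjTranspose_apply, Matrix.conjTranspose_mul,
        Matrix.conjTranspose_conjTranspose]
    rw [this, Complex.star_def, Complex.normSq_conj, mul_comm]
  set W : Matrix I I ℂ := O * Matrix.diagonal (fun a => (Real.sqrt (r a) : ℂ)) with hW
  have hWW : W * Wᴴ = eᴴ * ρ * e := by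
    have h1 : Matrix.diagonal (fun a => (Real.sqrt (r a) : ℂ)) *
        (Matrix.diagonal (fun a => (Real.sqrt (r a) : ℂ)))ᴴ =
        Matrix.diagonal (fun a => (r a : ℂ)) := by
      rw [Matrix.diagonal_conjTranspose, Matrix.diagonal_mul_diagonal]
      congr 1
      ext a
      rw [Pi.star_apply, Complex.star_def, Complex.conj_ofReal, ← Complex.ofReal_mul,
        Real.mul_self_sqrt (hr0 a)]
    rw [hW, Matrix.conjTranspose_mul, Matrix.mul_assoc, ← Matrix.mul_assoc (Matrix.diagonal _),
      h1, hO, Matrix.conjTranspose_mul, Matrix.conjTranspose_conjTranspose, hr.2]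
    simp only [Matrix.mul_assoc]
  have hWn : ∀ i a, Complex.normSq (W i a) = N i a * r a := by
    intro i a
    rw [hW, Matrix.mul_diagonal, Complex.normSq_mul, Complex.normSq_ofReal,
      Real.mul_self_sqrt (hr0 a)]
  have hbessel : ∀ a, ∑ i, N i a * r a / p i ≤ v := by
    intro a
    have h1 : ∀ c, ∑ i ∈ Finset.univ.filter (fun i => k i = c), N i a * r a / p i ≤ 1 := by
      intro c
      have h2 := sum_normSq_div_le_one (W := W) (p := p)
        (S := (Finset.univ.filter (fun i => k i = c)).filter (fun i => 0 < p i))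
        (fun i hi => (Finset.mem_filter.1 hi).2)
        (fun i _ => by rw [hWW, coe_qform hρ.1.1])
        (fun i hi j hj hij => by
          simp only [Finset.mem_filter, Finset.mem_univ, true_and] at hi hj
          rw [hWW, ho i j hij (hi.1.trans hj.1.symm)]) a
      simp only [hWn] at h2
      refine le_trans (le_of_eq ?_) h2
      refine (Finset.sum_filter_of_ne fun i _ hne => ?_).symm
      refine (hp0 i).lt_of_ne fun h => hne ?_
      rw [← h, div_zero]
    rw [← Finset.sum_fiberwise Finset.univ k]
    calc _ ≤ ∑ _c : κ, (1 : ℝ) := Finset.sum_le_sum fun c _ => h1 c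
      _ = v := by simp [hv]
  have hpt : ∀ i a, N i a * r a * (Real.log (r a) - Real.log (p i)) ≤
      N i a * r a * (Real.log v - 1) + v⁻¹ * (r a * (N i a * r a / p i)) := by
    intro i a
    rcases (mul_nonneg (hN0 i a) (hr0 a)).eq_or_lt with h | h
    · simp [← h]
    have hra : 0 < r a := (hr0 a).lt_of_ne fun h0 => by simp [← h0] at h
    have hpi : 0 < p i := by
      rw [hpN]
      exact h.trans_le (Finset.single_le_sum (f := fun a => N i a * r a)
        (fun b _ => mul_nonneg (hN0 i b) (hr0 b)) (Finset.mem_univ a))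
    have hl := Real.log_le_sub_one_of_pos (div_pos hra (mul_pos hv0 hpi))
    rw [Real.log_div hra.ne' (mul_pos hv0 hpi).ne', Real.log_mul hv0.ne' hpi.ne'] at hl
    have := mul_le_mul_of_nonneg_left hl h.le
    have e1 : N i a * r a * (r a / (v * p i) - 1) =
        v⁻¹ * (r a * (N i a * r a / p i)) - N i a * r a := by
      field_simp
    rw [e1] at this
    linarith
  have hsum := Finset.sum_le_sum fun a (_ : a ∈ Finset.univ) =>
    Finset.sum_le_sum fun i (_ : i ∈ Finset.univ) => hpt i a
  have hL : ∑ a, ∑ i, N i a * r a * (Real.log (r a) - Real.log (p i)) =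
      ∑ a, r a * Real.log (r a) - ∑ i, p i * Real.log (p i) := by
    simp only [mul_sub, Finset.sum_sub_distrib]
    congr 1
    · simp only [mul_assoc, ← Finset.sum_mul, hcol, one_mul]
    · rw [Finset.sum_comm]
      simp only [← Finset.sum_mul, ← hpN]
  have hR : ∑ a, ∑ i, (N i a * r a * (Real.log v - 1) + v⁻¹ * (r a * (N i a * r a / p i))) ≤
      Real.log v := by
    have hfst : ∑ a, ∑ i, N i a * r a * (Real.log v - 1) = Real.log v - 1 := by
      simp only [← Finset.sum_mul, hcol, one_mul, hr.sum_eq_one hρ]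
    simp only [Finset.sum_add_distrib, hfst, ← Finset.mul_sum]
    have h3 : ∑ a, r a * ∑ i, N i a * r a / p i ≤ v := by
      calc _ ≤ ∑ a, r a * v :=
            Finset.sum_le_sum fun a _ => mul_le_mul_of_nonneg_left (hbessel a) (hr0 a)
        _ = v := by rw [← Finset.sum_mul, hr.sum_eq_one hρ, one_mul]
    have h4 := mul_le_mul_of_nonneg_left h3 (inv_nonneg.2 hv0.le)
    rw [inv_mul_cancel₀ hv0.ne'] at h4
    linarith
  linarith

/-- A pair of classical distributions that reproduces `relEnt ρ ω` up to a logarithmic error and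
whose likelihood-ratio tests are dominated by quantum tests. -/
lemma exists_classical {ρ ω V : Matrix I I ℂ} {t : I → ℝ} (hρ : IsState ρ) (hω : IsState ω)
    (ht : SpecDec ω V t) {m : ℕ} (htm : ∀ j, (2 : ℝ) ^ (-(m : ℝ)) ≤ t j) :
    ∃ p q : I → ℝ, (∀ i, 0 ≤ p i) ∧ ∑ i, p i = 1 ∧ (∀ i, (2 : ℝ) ^ (-(m + 1 : ℝ)) ≤ q i) ∧
      (∀ γ : ℝ, 0 ≤ γ → ∀ S : Finset I,
        ∑ i ∈ S, (p i - γ * q i) ≤ trPos (ρ - (γ / 2) • ω)) ∧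
      relEnt ρ ω ≤ Real.logb 2 (m + 1) +
        ∑ i, p i * (Real.logb 2 (p i) - Real.logb 2 (q i)) := by
  have ht0 : ∀ j, 0 < t j := fun j => (Real.rpow_pos_of_pos two_pos _).trans_le (htm j)
  have hlog0 : ∀ j, 0 ≤ -Real.logb 2 (t j) := fun j =>
    neg_nonneg.2 (Real.logb_nonpos one_lt_two (ht0 j).le (ht.le_one hω j))
  have hlogm : ∀ j, -Real.logb 2 (t j) ≤ m := by
    intro j
    have := Real.logb_le_logb_of_le one_lt_two (Real.rpow_pos_of_pos two_pos _) (htm j)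
    rw [Real.logb_rpow two_pos (by norm_num)] at this
    linarith
  set k : I → Fin (m + 1) := fun j => ⟨⌊-Real.logb 2 (t j)⌋₊,
    Nat.lt_succ_of_le (Nat.floor_le_of_le (hlogm j))⟩ with hk
  have hk1 : ∀ j, ((k j : ℕ) : ℝ) ≤ -Real.logb 2 (t j) := fun j => Nat.floor_le (hlog0 j)
  have hk2 : ∀ j, -Real.logb 2 (t j) ≤ (k j : ℕ) + 1 := fun j => (Nat.lt_floor_add_one _).le
  obtain ⟨U, r, hr⟩ := exists_specDec hρ.1.1
  have hVρ : (Vᴴ * ρ * V).IsHermitian := (hρ.1.conjTranspose_mul_mul_same V).1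
  obtain ⟨B, hB, hB0, hBo⟩ := exists_block_unitary k hVρ
  have hconj : ∀ A : Matrix I I ℂ, (V * B)ᴴ * A * (V * B) = Bᴴ * (Vᴴ * A * V) * B := by
    intro A
    rw [Matrix.conjTranspose_mul]
    simp only [Matrix.mul_assoc]
  have he : V * B ∈ Matrix.unitaryGroup I ℂ := mul_mem ht.1 hB
  have hent := sum_mul_log_le_of_blocks k hρ hr he fun i j hij hkij => by
    rw [hconj]
    exact hBo i j hij hkij
  have hq : ∀ i, qform ω (V * B) i ≤ 2 * (2 : ℝ) ^ (-((k i : ℕ) + 1 : ℝ)) := by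
    intro i
    rw [qform_eq ht, ← Matrix.mul_assoc, unitary_conjTranspose_mul ht.1, Matrix.one_mul]
    have hle : ∀ j, t j * Complex.normSq (B j i) ≤
        2 * (2 : ℝ) ^ (-((k i : ℕ) + 1 : ℝ)) * Complex.normSq (B j i) := by
      intro j
      by_cases hji : k j = k i
      · refine mul_le_mul_of_nonneg_right ?_ (Complex.normSq_nonneg _)
        rw [neg_add, Real.rpow_add two_pos, Real.rpow_neg_one, ← hji]
        have h1 : t j ≤ 2 ^ (-((k j : ℕ) : ℝ)) := by
          rw [← Real.logb_le_iff_le_rpow one_lt_two (ht0 j)]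
          linarith [hk1 j]
        linarith
      · simp [hB0 j i hji]
    calc _ ≤ ∑ j, 2 * (2 : ℝ) ^ (-((k i : ℕ) + 1 : ℝ)) * Complex.normSq (B j i) :=
          Finset.sum_le_sum fun j _ => hle j
      _ = _ := by rw [← Finset.mul_sum, sum_normSq_col hB, mul_one]
  have htr : ∑ i, qform ρ (V * B) i * ((k i : ℕ) + 1 : ℝ) =
      ∑ j, qform ρ V j * ((k j : ℕ) + 1 : ℝ) := by
    set D : Matrix I I ℂ := Matrix.diagonal fun i => (((k i : ℕ) + 1 : ℝ) : ℂ) with hD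
    have hcomm : B * D = D * B := by
      ext i j
      rw [hD, Matrix.mul_diagonal, Matrix.diagonal_mul]
      by_cases hij : k i = k j
      · rw [hij, mul_comm]
      · simp [hB0 i j hij]
    have hre : ∀ X : Matrix I I ℂ, (X * D).trace.re =
        ∑ i, (X i i).re * ((k i : ℕ) + 1 : ℝ) := by
      intro X
      rw [Matrix.trace, Complex.re_sum]
      refine Finset.sum_congr rfl fun i _ => ?_
      rw [Matrix.diag_apply, hD, Matrix.mul_diagonal, Complex.re_mul_ofReal]
    have h1 := hre ((V * B)ᴴ * ρ * (V * B))
    have h2 := hre (Vᴴ * ρ * V)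
    unfold qform
    rw [← h1, ← h2, hconj, Matrix.mul_assoc, hcomm, Matrix.mul_assoc, Matrix.trace_mul_comm,
      Matrix.mul_assoc, Matrix.mul_assoc, Matrix.mul_assoc D, unitary_mul_conjTranspose hB,
      Matrix.mul_one, ← Matrix.mul_assoc]
  refine ⟨qform ρ (V * B), fun i => (2 : ℝ) ^ (-((k i : ℕ) + 1 : ℝ)), qform_nonneg hρ.1 _, ?_, ?_,
    ?_, ?_⟩
  · rw [sum_qform he, hρ.2, Complex.one_re]
  · intro i
    refine Real.rpow_le_rpow_of_exponent_le one_le_two ?_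
    have : ((k i : ℕ) : ℝ) ≤ m := by exact_mod_cast Nat.le_of_lt_succ (k i).2
    linarith
  · intro γ hγ S
    refine le_trans (Finset.sum_le_sum fun i _ => ?_)
      (sum_qform_le_trPos (isHermitian_sub_smul hρ.1.1 hω.1.1 (γ / 2)) he S)
    rw [qform_sub, qform_smul]
    have := mul_le_mul_of_nonneg_left (hq i) (div_nonneg hγ zero_le_two)
    linarith
  · rw [relEnt_eq hr ht (hr.nonneg hρ.1) fun i => (ht0 i).le]
    have h2 : 0 < Real.log 2 := Real.log_pos one_lt_two
    have hent2 : ∑ a, r a * Real.logb 2 (r a) ≤ Real.logb 2 (m + 1) +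
        ∑ i, qform ρ (V * B) i * Real.logb 2 (qform ρ (V * B) i) := by
      have := div_le_div_of_nonneg_right hent h2.le
      rw [add_div, Finset.sum_div, Finset.sum_div, Fintype.card_fin] at this
      simpa only [Real.logb, mul_div_assoc, Nat.cast_add, Nat.cast_one] using this
    have hq2 : ∀ i, Real.logb 2 ((2 : ℝ) ^ (-((k i : ℕ) + 1 : ℝ))) = -((k i : ℕ) + 1 : ℝ) :=
      fun i => Real.logb_rpow two_pos (by norm_num)
    simp only [hq2, sub_neg_eq_add, mul_add (qform ρ (V * B) _), Finset.sum_add_distrib]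
    simp only [mul_add, Finset.sum_add_distrib] at htr
    have h5 : -∑ j, qform ρ V j * Real.logb 2 (t j) ≤
        ∑ j, qform ρ V j * ((k j : ℕ) + 1 : ℝ) := by
      rw [← Finset.sum_neg_distrib]
      refine Finset.sum_le_sum fun j _ => ?_
      rw [← mul_neg]
      exact mul_le_mul_of_nonneg_left (hk2 j) (qform_nonneg hρ.1 V j)
    simp only [mul_add, Finset.sum_add_distrib] at h5
    linarith

/-- A bound on a classical relative entropy through the tails of the log-likelihood ratio. -/
lemma sum_mul_logb_sub_le {p q : I → ℝ} (hp : ∀ i, 0 ≤ p i) (hp1 : ∑ i, p i = 1) {m : ℕ}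
    (hq : ∀ i, (2 : ℝ) ^ (-(m + 1 : ℝ)) ≤ q i) {a b C : ℝ} (hab : a ≤ b)
    (hbC : (m + 1 : ℝ) ≤ b + C) :
    ∑ i, p i * (Real.logb 2 (p i) - Real.logb 2 (q i)) ≤
      a + (b - a) * ∑ i ∈ Finset.univ.filter (fun i => 2 ^ a * q i < p i), p i +
        C * ∑ i ∈ Finset.univ.filter (fun i => 2 ^ b * q i < p i), p i := by
  have hq0 : ∀ i, 0 < q i := fun i => (Real.rpow_pos_of_pos two_pos _).trans_le (hq i)
  have hlog : ∀ (i : I) (c : ℝ), 0 < p i → p i ≤ 2 ^ c * q i →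
      Real.logb 2 (p i) - Real.logb 2 (q i) ≤ c := by
    intro i c hpi h
    have := Real.logb_le_logb_of_le one_lt_two hpi h
    rw [Real.logb_mul (Real.rpow_pos_of_pos two_pos _).ne' (hq0 i).ne',
      Real.logb_rpow two_pos (by norm_num)] at this
    linarith
  have hp_le : ∀ i, p i ≤ 2 ^ (m + 1 : ℝ) * q i := by
    intro i
    have h1 : p i ≤ 1 := hp1 ▸ Finset.single_le_sum (fun j _ => hp j) (Finset.mem_univ i)
    have h2 := mul_le_mul_of_nonneg_left (hq i)
      (Real.rpow_nonneg zero_le_two (m + 1 : ℝ))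
    rw [← Real.rpow_add two_pos, add_neg_cancel, Real.rpow_zero] at h2
    exact h1.trans h2
  calc ∑ i, p i * (Real.logb 2 (p i) - Real.logb 2 (q i))
      ≤ ∑ i, (p i * a + (b - a) * (if 2 ^ a * q i < p i then p i else 0) +
          C * (if 2 ^ b * q i < p i then p i else 0)) := by
        refine Finset.sum_le_sum fun i _ => ?_
        rcases (hp i).eq_or_lt with h0 | h0
        · simp [← h0]
        have hba : 2 ^ a * q i ≤ 2 ^ b * q i := mul_le_mul_of_nonneg_right
          (Real.rpow_le_rpow_of_exponent_le one_le_two hab) (hq0 i).le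
        have key : ∀ c, Real.logb 2 (p i) - Real.logb 2 (q i) ≤ c →
            p i * (Real.logb 2 (p i) - Real.logb 2 (q i)) ≤ p i * c :=
          fun c hc => mul_le_mul_of_nonneg_left hc h0.le
        split_ifs with h1 h2 h2
        · nlinarith [key _ (hlog i _ h0 (hp_le i)), mul_le_mul_of_nonneg_left hbC h0.le]
        · linarith [key _ (hlog i _ h0 (not_lt.1 h2))]
        · exact absurd (hba.trans_lt h2) h1
        · linarith [key _ (hlog i _ h0 (not_lt.1 h1))]
    _ = _ := by
        rw [Finset.sum_add_distrib, Finset.sum_add_distrib, ← Finset.sum_mul, hp1, one_mul,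
          ← Finset.mul_sum, ← Finset.mul_sum, Finset.sum_filter, Finset.sum_filter]

/-- One-shot bound on the relative entropy in terms of two hypothesis-testing values. -/
lemma relEnt_le_of_trPos {ρ ω V : Matrix I I ℂ} {t : I → ℝ} (hρ : IsState ρ) (hω : IsState ω)
    (ht : SpecDec ω V t) {m : ℕ} (htm : ∀ j, (2 : ℝ) ^ (-(m : ℝ)) ≤ t j) {a b C η : ℝ}
    (hab : a ≤ b) (hη : 0 < η) (hC : 0 ≤ C) (hbC : (m + 1 : ℝ) ≤ b + η + C) :
    relEnt ρ ω ≤ Real.logb 2 (m + 1) + (a + η) +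
      (b - a) * (trPos (ρ - ((2 : ℝ) ^ a / 2) • ω) / (1 - 2 ^ (-η))) +
        C * (trPos (ρ - ((2 : ℝ) ^ b / 2) • ω) / (1 - 2 ^ (-η))) := by
  obtain ⟨p, q, hp, hp1, hq, htest, hent⟩ := exists_classical hρ hω ht htm
  have hθ : (0 : ℝ) < 1 - 2 ^ (-η) :=
    sub_pos.2 (Real.rpow_lt_one_of_one_lt_of_neg one_lt_two (neg_neg_of_pos hη))
  have htail : ∀ c : ℝ, ∑ i ∈ Finset.univ.filter (fun i => 2 ^ (c + η) * q i < p i), p i ≤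
      trPos (ρ - ((2 : ℝ) ^ c / 2) • ω) / (1 - 2 ^ (-η)) := by
    intro c
    rw [le_div_iff₀ hθ]
    refine le_trans ?_ (htest _ (Real.rpow_nonneg zero_le_two c)
      (Finset.univ.filter (fun i => 2 ^ (c + η) * q i < p i)))
    rw [Finset.sum_mul]
    refine Finset.sum_le_sum fun i hi => ?_
    have hi := (Finset.mem_filter.1 hi).2
    have h1 := mul_lt_mul_of_pos_left hi (Real.rpow_pos_of_pos (two_pos (α := ℝ)) (-η))
    rw [← mul_assoc, ← Real.rpow_add two_pos, neg_add_cancel_comm_assoc] at h1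
    linarith
  have h := sum_mul_logb_sub_le hp hp1 hq (add_le_add_left hab η) hbC
  have h1 := mul_le_mul_of_nonneg_left (htail a) (sub_nonneg.2 hab)
  have h2 := mul_le_mul_of_nonneg_left (htail b) hC
  rw [add_sub_add_right_eq_sub] at h
  linarith

lemma EMset_le_relEnt {M : Set (Matrix I I ℂ)} (hM : ∀ ω ∈ M, IsState ω) {ρ ω : Matrix I I ℂ}
    (hρ : IsState ρ) (hω : ω ∈ M) (hs : SuppLe ρ ω) : EMset M ρ ≤ relEnt ρ ω := by
  refine csInf_le ?_ ⟨ω, hω, hs, rfl⟩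
  obtain ⟨U, r, hr⟩ := exists_specDec hρ.1.1
  refine ⟨∑ i, r i * Real.logb 2 (r i), ?_⟩
  rintro _ ⟨τ, hτ, -, rfl⟩
  obtain ⟨V, t, ht⟩ := exists_specDec (hM τ hτ).1.1
  have ht0 := ht.nonneg (hM τ hτ).1
  rw [relEnt_eq hr ht (hr.nonneg hρ.1) ht0, le_sub_self_iff]
  exact Finset.sum_nonpos fun j _ => mul_nonpos_of_nonneg_of_nonpos (qform_nonneg hρ.1 V j)
    (Real.logb_nonpos one_lt_two (ht0 j) (ht.le_one (hM τ hτ) j))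

section Family

variable {d : ℕ} {σ : Matrix (Fin d) (Fin d) ℂ}
  {M : ∀ n : ℕ, Set (Matrix (Fin n → Fin d) (Fin n → Fin d) ℂ)}

/-- The quadratic forms of `σ^{⊗n}` decay at most exponentially in `n`. -/
lemma exists_le_qform_tpow (hσ : σ.PosDef) :
    ∃ m : ℕ, 0 < m ∧ ∀ n, ∀ U ∈ Matrix.unitaryGroup (Fin n → Fin d) ℂ, ∀ i,
      (2 : ℝ) ^ (-((m * n : ℕ) : ℝ)) ≤ qform (tpow σ n) U i := by
  obtain ⟨V, a, h, h0⟩ := exists_specDec_pos hσ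
  have hev : ∀ᶠ m : ℕ in atTop, ∀ i, ((1 : ℝ) / 2) ^ m < a i := eventually_all.2 fun i =>
    (tendsto_pow_atTop_nhds_zero_of_lt_one (by norm_num) (by norm_num)).eventually
      (gt_mem_nhds (h0 i))
  obtain ⟨m, hm, hm0⟩ := (hev.and (eventually_gt_atTop 0)).exists
  refine ⟨m, hm0, fun n U hU i => ?_⟩
  have hX : (tpow V n)ᴴ * U ∈ Matrix.unitaryGroup (Fin n → Fin d) ℂ :=
    mul_mem (conjTranspose_mem_unitary (h.tpow n).1) hU
  rw [qform_eq (h.tpow n)]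
  calc (2 : ℝ) ^ (-((m * n : ℕ) : ℝ))
      = ∑ j, (2 : ℝ) ^ (-((m * n : ℕ) : ℝ)) * Complex.normSq (((tpow V n)ᴴ * U) j i) := by
        rw [← Finset.mul_sum, sum_normSq_col hX, mul_one]
    _ ≤ _ := by
        refine Finset.sum_le_sum fun x _ =>
          mul_le_mul_of_nonneg_right ?_ (Complex.normSq_nonneg _)
        calc (2 : ℝ) ^ (-((m * n : ℕ) : ℝ)) = ∏ _i : Fin n, ((1 : ℝ) / 2) ^ m := by
              rw [Finset.prod_const, Finset.card_univ, Fintype.card_fin, ← pow_mul,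
                Real.rpow_neg zero_le_two, Real.rpow_natCast, one_div, inv_pow]
          _ ≤ ∏ l, a (x l) := Finset.prod_le_prod (fun _ _ => by positivity)
              fun l _ => (hm (x l)).le

/-- Bound on the relative entropy to `M n` by mixing two near-optimal tests with `σ^{⊗n}`. -/
lemma GoodFamily.EMset_le (hM : GoodFamily σ M) {m : ℕ}
    (hm : ∀ n, ∀ U ∈ Matrix.unitaryGroup (Fin n → Fin d) ℂ, ∀ i,
      (2 : ℝ) ^ (-((m * n : ℕ) : ℝ)) ≤ qform (tpow σ n) U i)
    {n : ℕ} {ρ ω τ : Matrix (Fin n → Fin d) (Fin n → Fin d) ℂ} (hρ : IsState ρ) (hω : ω ∈ M n)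
    (hτ : τ ∈ M n) {a b η : ℝ} (hab : a ≤ b) (hη : 0 < η) :
    EMset (M n) ρ ≤ Real.logb 2 (m * n + 3) + (Real.logb 2 6 + a + η) +
      (b - a) * (trPos (ρ - (2 : ℝ) ^ a • ω) / (1 - 2 ^ (-η))) +
      (m * n + 3 + |b|) * (trPos (ρ - (2 : ℝ) ^ b • τ) / (1 - 2 ^ (-η))) := by
  have hωs := hM.states n ω hω
  have hτs := hM.states n τ hτ
  have hσs := hM.states n _ (hM.sigma_mem n)
  set W := (1 / 3 : ℝ) • ω + (2 / 3 : ℝ) • ((1 / 2 : ℝ) • τ + (1 / 2 : ℝ) • tpow σ n) with hW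
  have hWM : W ∈ M n := hM.convex n hω (hM.convex n hτ (hM.sigma_mem n) (by norm_num)
    (by norm_num) (by norm_num)) (by norm_num) (by norm_num) (by norm_num)
  have hWs := hM.states n W hWM
  have hWq : ∀ U i, qform W U i =
      (qform ω U i + qform τ U i + qform (tpow σ n) U i) / 3 := by
    intro U i
    simp only [hW, qform_add, qform_smul]
    ring
  obtain ⟨V, t, ht⟩ := exists_specDec hWs.1.1
  have htm : ∀ j, (2 : ℝ) ^ (-((m * n + 2 : ℕ) : ℝ)) ≤ t j := by
    intro j
    rw [← qform_self ht, hWq, Nat.cast_add, neg_add, Real.rpow_add two_pos]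
    have h1 := hm n V ht.1 j
    have h2 : (0 : ℝ) < (2 : ℝ) ^ (-((m * n : ℕ) : ℝ)) := Real.rpow_pos_of_pos two_pos _
    have h3 : (2 : ℝ) ^ (-((2 : ℕ) : ℝ)) = 1 / 4 := by
      rw [Real.rpow_neg zero_le_two, Real.rpow_natCast]
      norm_num
    rw [h3]
    linarith [qform_nonneg hωs.1 V j, qform_nonneg hτs.1 V j]
  have h6 : 0 ≤ Real.logb 2 6 := Real.logb_nonneg one_lt_two (by norm_num)
  have hpow : ∀ c : ℝ, (2 : ℝ) ^ (Real.logb 2 6 + c) / 2 = 3 * 2 ^ c := by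
    intro c
    rw [Real.rpow_add two_pos, Real.rpow_logb two_pos (by norm_num) (by norm_num)]
    ring
  have hθ : (0 : ℝ) < 1 - 2 ^ (-η) :=
    sub_pos.2 (Real.rpow_lt_one_of_one_lt_of_neg one_lt_two (neg_neg_of_pos hη))
  have hC : (0 : ℝ) ≤ m * n + 3 + |b| := by positivity
  have hmain := relEnt_le_of_trPos hρ hWs ht htm (a := Real.logb 2 6 + a)
    (b := Real.logb 2 6 + b) (C := m * n + 3 + |b|) (η := η) (by linarith) hη hC
    (by push_cast; linarith [neg_abs_le b])
  rw [hpow, hpow, add_sub_add_left_eq_sub] at hmain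
  have hcoe : (((m * n + 2 : ℕ) : ℝ) + 1) = m * n + 3 := by
    push_cast
    ring
  rw [hcoe] at hmain
  refine (EMset_le_relEnt (hM.states n) hρ hWM (suppLe_of_pos ρ ht fun j =>
    (Real.rpow_pos_of_pos two_pos _).trans_le (htm j))).trans (hmain.trans ?_)
  have hc : ∀ c : ℝ, (0 : ℝ) < 2 ^ c := fun c => Real.rpow_pos_of_pos two_pos c
  have h1 : trPos (ρ - (3 * (2 : ℝ) ^ a) • W) ≤ trPos (ρ - (2 : ℝ) ^ a • ω) := by
    refine trPos_sub_smul_le hρ.1.1 hWs.1.1 hωs.1.1 fun U i => ?_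
    rw [hWq]
    nlinarith [mul_nonneg (hc a).le (qform_nonneg hτs.1 U i),
      mul_nonneg (hc a).le (qform_nonneg hσs.1 U i)]
  have h2 : trPos (ρ - (3 * (2 : ℝ) ^ b) • W) ≤ trPos (ρ - (2 : ℝ) ^ b • τ) := by
    refine trPos_sub_smul_le hρ.1.1 hWs.1.1 hτs.1.1 fun U i => ?_
    rw [hWq]
    nlinarith [mul_nonneg (hc b).le (qform_nonneg hωs.1 U i),
      mul_nonneg (hc b).le (qform_nonneg hσs.1 U i)]
  have hba : 0 ≤ b - a := by linarith
  gcongr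

lemma GoodFamily.exists_trPos_lt (hM : GoodFamily σ M) {n : ℕ}
    {A : Matrix (Fin n → Fin d) (Fin n → Fin d) ℂ} {l c : ℝ}
    (h : sInf {x : ℝ | ∃ ω ∈ M n, x = trPos (A - l • ω)} < c) :
    ∃ ω ∈ M n, trPos (A - l • ω) < c := by
  obtain ⟨_, ⟨ω, hω, rfl⟩, hlt⟩ := exists_lt_of_csInf_lt
    (s := {x : ℝ | ∃ ω ∈ M n, x = trPos (A - l • ω)}) ⟨_, tpow σ n, hM.sigma_mem n, rfl⟩ h
  exact ⟨ω, hω, hlt⟩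

lemma tendsto_logb_linear_div {m : ℕ} (hm : 0 < m) :
    Tendsto (fun n : ℕ => Real.logb 2 (m * n + 3) / n) atTop (nhds 0) := by
  have hx : Tendsto (fun n : ℕ => (m * n + 3 : ℝ)) atTop atTop :=
    tendsto_atTop_add_const_right _ _
      (tendsto_natCast_atTop_atTop.const_mul_atTop (by exact_mod_cast hm))
  have h1 := (Real.isLittleO_log_id_atTop.tendsto_div_nhds_zero.comp hx)
  have h2 : Tendsto (fun n : ℕ => (m : ℝ) + 3 / n) atTop (nhds m) := by
    simpa using tendsto_const_nhds.add (tendsto_const_div_atTop_nhds_zero_nat (3 : ℝ))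
  have h3 := (h1.mul h2).div_const (Real.log 2)
  rw [zero_mul, zero_div] at h3
  refine h3.congr' ?_
  filter_upwards [eventually_gt_atTop 0] with n hn
  have hn' : (0 : ℝ) < n := by exact_mod_cast hn
  have : (0 : ℝ) < m * n + 3 := by positivity
  simp only [Function.comp, id, Real.logb]
  field_simp

/-- Direct part: below the regularized relative entropy the optimal value tends to one. -/
lemma GoodFamily.tendsto_one (hM : GoodFamily σ M) {ρ : Matrix (Fin d) (Fin d) ℂ}
    (hρ : IsState ρ) {E : ℝ}
    (hE : Tendsto (fun n : ℕ => EMset (M n) (tpow ρ n) / n) atTop (nhds E))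
    {y : ℝ} (hy : y < E) :
    Tendsto (fun n : ℕ =>
      sInf {x : ℝ | ∃ ω ∈ M n, x = trPos (tpow ρ n - ((2 : ℝ) ^ (y * (n : ℝ))) • ω)})
      atTop (nhds 1) := by
  obtain ⟨m, hm0, hm⟩ := exists_le_qform_tpow hM.sigma_posdef
  refine tendsto_order.2 ⟨fun c hc => ?_, fun c hc => Eventually.of_forall fun n => ?_⟩
  swap
  · exact ((hM.sInf_le_trPos hρ (hM.sigma_mem n)).trans (trPos_sub_smul_le_one
      (isState_tpow hρ n) (hM.states n _ (hM.sigma_mem n))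
      (Real.rpow_nonneg zero_le_two _))).trans_lt hc
  obtain ⟨c', hcc', hc'⟩ := exists_between hc
  set δ := (1 - c') * (E - y) / 3 with hδ
  have hδ0 : 0 < δ := div_pos (mul_pos (by linarith) (by linarith)) (by norm_num)
  set z := E + δ with hz
  set h : ℕ → ℝ := fun n =>
    sInf {x : ℝ | ∃ ω ∈ M n, x = trPos (tpow ρ n - ((2 : ℝ) ^ (z * (n : ℝ))) • ω)} with hh
  have hlim0 : Tendsto h atTop (nhds 0) := hM.tendsto_zero hρ hE (by linarith)
  set θ : ℕ → ℝ := fun n => 1 - 2 ^ (-(δ * n)) with hθ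
  have hθ1 : Tendsto θ atTop (nhds 1) := by
    have h1 : Tendsto (fun n : ℕ => ((2 : ℝ) ^ (-δ)) ^ n) atTop (nhds 0) :=
      tendsto_pow_atTop_nhds_zero_of_lt_one (Real.rpow_nonneg zero_le_two _)
        (Real.rpow_lt_one_of_one_lt_of_neg one_lt_two (by linarith))
    have h2 := h1.const_sub 1
    rw [sub_zero] at h2
    refine h2.congr fun n => ?_
    rw [hθ, ← Real.rpow_natCast, ← Real.rpow_mul zero_le_two, neg_mul]
  have hbound : Tendsto (fun n : ℕ => Real.logb 2 (m * n + 3) / n +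
      (Real.logb 2 6 / n + y + δ) + (z - y) * (c' / θ n) +
      (m + 3 / n + |z|) * ((h n + 1 / n) / θ n)) atTop
      (nhds (0 + (0 + y + δ) + (z - y) * (c' / 1) + (m + 0 + |z|) * ((0 + 0) / 1))) := by
    refine ((tendsto_logb_linear_div hm0).add ?_ |>.add ?_).add ?_
    · exact ((tendsto_const_div_atTop_nhds_zero_nat _).add_const y).add_const δ
    · exact (tendsto_const_nhds.div hθ1 one_ne_zero).const_mul _
    · exact ((tendsto_const_nhds.add (tendsto_const_div_atTop_nhds_zero_nat _)).add_const _).mul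
        ((hlim0.add (tendsto_const_div_atTop_nhds_zero_nat _)).div hθ1 one_ne_zero)
  have hlt : 0 + (0 + y + δ) + (z - y) * (c' / 1) + ((m : ℝ) + 0 + |z|) * ((0 + 0) / 1) < E := by
    have e1 : (1 - c') * (E - y) = 3 * δ := by
      rw [hδ]
      ring
    have : δ * c' < δ := by nlinarith
    rw [hz]
    nlinarith
  filter_upwards [hbound.eventually_lt hE hlt, eventually_gt_atTop 0] with n hn hn0
  have hn' : (0 : ℝ) < n := by exact_mod_cast hn0
  refine lt_of_not_ge fun hle => not_lt.2 ?_ hn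
  obtain ⟨ω, hω, hωlt⟩ := hM.exists_trPos_lt (hle.trans_lt hcc')
  obtain ⟨τ, hτ, hτlt⟩ := hM.exists_trPos_lt
    (show h n < h n + 1 / n from lt_add_of_pos_right _ (by positivity))
  have hzy : 0 < z - y := by linarith
  have hθ0 : 0 < θ n := sub_pos.2 (Real.rpow_lt_one_of_one_lt_of_neg one_lt_two
    (neg_neg_of_pos (mul_pos hδ0 hn')))
  have hEM := hM.EMset_le hm (isState_tpow hρ n) hω hτ (a := y * n) (b := z * n) (η := δ * n)
    (mul_le_mul_of_nonneg_right (by linarith) hn'.le) (mul_pos hδ0 hn')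
  rw [div_le_iff₀ hn']
  refine hEM.trans ?_
  calc _ ≤ Real.logb 2 (m * n + 3) + (Real.logb 2 6 + y * n + δ * n) +
        (z * n - y * n) * (c' / θ n) + (m * n + 3 + |z * n|) * ((h n + 1 / n) / θ n) := by
        have : 0 ≤ z * n - y * n := by
          rw [← sub_mul]
          positivity
        gcongr
    _ = _ := by
        rw [abs_mul, abs_of_pos hn']
        field_simp

end Family

/-- **Proposition (main compact form).**  For a family `{M n}` satisfying properties
1–5 and a state `ρ` with `E = E_M^∞(ρ)`, the quantity
`min_{ω ∈ M n} tr(ρ^{⊗n} − 2^{yn} ω)₊` tends to `0` when `y > E` and to `1` when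
`y < E`. -/
theorem main_proposition_compact {d : ℕ} (σ : Matrix (Fin d) (Fin d) ℂ)
    (M : ∀ n : ℕ, Set (Matrix (Fin n → Fin d) (Fin n → Fin d) ℂ))
    (hM : GoodFamily σ M)
    (ρ : Matrix (Fin d) (Fin d) ℂ) (hρ : IsState ρ)
    (E : ℝ)
    (hE : Filter.Tendsto (fun n : ℕ => EMset (M n) (tpow ρ n) / n) Filter.atTop (nhds E)) :
    (∀ y : ℝ, E < y →
      Filter.Tendsto (fun n : ℕ =>
          sInf {x : ℝ | ∃ ω ∈ M n, x = trPos (tpow ρ n - ((2:ℝ) ^ (y * (n:ℝ))) • ω)})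
        Filter.atTop (nhds 0)) ∧
    (∀ y : ℝ, y < E →
      Filter.Tendsto (fun n : ℕ =>
          sInf {x : ℝ | ∃ ω ∈ M n, x = trPos (tpow ρ n - ((2:ℝ) ^ (y * (n:ℝ))) • ω)})
        Filter.atTop (nhds 1)) := by
  exact ⟨fun _ hy => hM.tendsto_zero hρ hE hy, fun _ hy => hM.tendsto_one hρ hE hy⟩

end GQSL
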